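/- arXiv:2312.11616 — 4 statements merged into one kernel-verified Lean document; each statement's English description precedes it below -/
import Mathlib

section
/- Let α = e^{2πi/3}. For every γ ∈ SL(2,ℤ), the weight-2 quasimodular Eisenstein series satisfies E₂(γ·i) ≠ 0 and E₂(γ·α) ≠ 0, where γ·τ = (aτ+b)/(cτ+d) for γ = (a b; c d). -/
open Complex

noncomputable section

/-- `e^{2πiτs}`, i.e. `q^s` for `q = e^{2πiτ}`. -/
def qp (τ s : ℂ) : ℂ := Complex.exp (2 * (Real.pi : ℂ) * Complex.I * τ * s)

/-- Sum of the `k`-th powers of the positive divisors of `n`. -/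
def sigmaFn (k n : ℕ) : ℕ := ∑ d ∈ n.divisors, d ^ k

/-- The weight-2 quasimodular Eisenstein series
`E₂(τ) = 1 − 24 ∑_{n≥1} σ₁(n) qⁿ`. -/
def E2 (τ : ℂ) : ℂ := 1 - 24 * ∑' n : ℕ, (sigmaFn 1 (n + 1) : ℂ) * qp τ ((n : ℂ) + 1)

abbrev SL2Z := Matrix.SpecialLinearGroup (Fin 2) ℤ

/-- Möbius action of `SL(2,ℤ)` on the upper half-plane:
`γ·τ = (aτ+b)/(cτ+d)`. -/
def acts (γ : SL2Z) (τ : ℂ) : ℂ :=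
  ((γ.1 0 0 : ℂ) * τ + (γ.1 0 1 : ℂ)) / ((γ.1 1 0 : ℂ) * τ + (γ.1 1 1 : ℂ))

/-- `α = e^{2πi/3}`. -/
def alphaPt : ℂ := Complex.exp (2 * (Real.pi : ℂ) * Complex.I / 3)

lemma E2_eq_mathlib (z : UpperHalfPlane) : E2 (z : ℂ) = EisensteinSeries.E2 z := by
  rw [EisensteinSeries.E2_eq_tsum_cexp, tsum_pnat_eq_tsum_succ
    (f := fun n ↦ (ArithmeticFunction.sigma 1 n : ℂ) *
      Complex.exp (2 * Real.pi * Complex.I * z) ^ n), E2]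
  congr 2
  apply tsum_congr
  intro n
  rw [← Complex.exp_nat_mul, qp, sigmaFn, ArithmeticFunction.sigma_apply]
  congr 2
  push_cast
  ring

lemma denom_ne (γ : SL2Z) (z : UpperHalfPlane) :
    (γ.1 1 0 : ℂ) * z + (γ.1 1 1 : ℂ) ≠ 0 := by
  rw [← ModularGroup.denom_apply]
  exact UpperHalfPlane.denom_ne_zero _ z

lemma E2_transform (γ : SL2Z) (z : UpperHalfPlane) :
    E2 (acts γ z) = ((γ.1 1 0 : ℂ) * z + (γ.1 1 1 : ℂ)) ^ 2 * E2 z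
      - 6 * Complex.I / Real.pi * (γ.1 1 0 : ℂ) * ((γ.1 1 0 : ℂ) * z + (γ.1 1 1 : ℂ)) := by
  have h1 : acts γ z = ((γ • z : UpperHalfPlane) : ℂ) := by
    rw [UpperHalfPlane.coe_specialLinearGroup_apply]
    simp [acts]
  have h := congrFun (EisensteinSeries.E2_slash_action γ) z
  rw [ModularForm.SL_slash_apply] at h
  simp only [Pi.sub_apply, Pi.smul_apply, EisensteinSeries.D2, ModularGroup.denom_apply,
    riemannZeta_two, smul_eq_mul] at h
  rw [h1, E2_eq_mathlib, E2_eq_mathlib]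
  have hw := denom_ne γ z
  have hpi : (Real.pi : ℂ) ≠ 0 := by exact_mod_cast Real.pi_ne_zero
  set w : ℂ := (γ.1 1 0 : ℂ) * z + (γ.1 1 1 : ℂ)
  have h2 : EisensteinSeries.E2 (γ • z) = (EisensteinSeries.E2 (γ • z) * w ^ (-2 : ℤ)) * w ^ 2 := by
    rw [zpow_neg]
    field_simp
  rw [h2, h]
  field_simp

lemma E2_ne_zero_aux (γ : SL2Z) (z : UpperHalfPlane)
    (hz : E2 z * ((z : ℂ) - (starRingEnd ℂ) z) = 6 * Complex.I / Real.pi) :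
    E2 (acts γ z) ≠ 0 := by
  intro h0
  have ht := E2_transform γ z
  have hw := denom_ne γ z
  have hw' : (γ.1 1 0 : ℂ) * (starRingEnd ℂ) z + (γ.1 1 1 : ℂ) ≠ 0 := by
    intro h
    apply hw
    have := congrArg (starRingEnd ℂ) h
    simpa using this
  have hpi : (Real.pi : ℂ) ≠ 0 := by exact_mod_cast Real.pi_ne_zero
  have hk : 6 * Complex.I / Real.pi ≠ 0 :=
    div_ne_zero (mul_ne_zero (by norm_num) Complex.I_ne_zero) hpi
  apply mul_ne_zero (mul_ne_zero hk hw) hw'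
  rw [h0, ← hz] at ht
  rw [← hz]
  linear_combination (-((z : ℂ) - (starRingEnd ℂ) z)) * ht

lemma alpha_eq : alphaPt = -1 / 2 + (Real.sqrt 3 / 2 : ℝ) * Complex.I := by
  have h : (2 * (Real.pi : ℂ) * Complex.I / 3) = ((Real.pi - Real.pi / 3 : ℝ) : ℂ) * Complex.I := by
    push_cast
    ring
  rw [alphaPt, h, Complex.exp_mul_I, ← Complex.ofReal_cos, ← Complex.ofReal_sin,
    Real.cos_pi_sub, Real.sin_pi_sub, Real.cos_pi_div_three, Real.sin_pi_div_three]
  push_cast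
  ring

lemma alpha_im : 0 < alphaPt.im := by
  rw [alpha_eq]
  simp

lemma alpha_conj : (starRingEnd ℂ) alphaPt = -1 - alphaPt := by
  have hre : alphaPt.re = -1 / 2 := by
    rw [alpha_eq]
    simp
  apply Complex.ext
  · simp only [Complex.conj_re, Complex.sub_re, Complex.neg_re, Complex.one_re, hre]
    norm_num
  · simp

lemma alpha_sq : alphaPt ^ 2 + alphaPt + 1 = 0 := by
  rw [alpha_eq]
  have h3 : (Real.sqrt 3 : ℂ) ^ 2 = 3 := by
    norm_cast
    exact Real.sq_sqrt (by norm_num)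
  push_cast
  linear_combination (-1 / 4 : ℂ) * h3 + (Real.sqrt 3 : ℂ) ^ 2 / 4 * Complex.I_sq

/-- For every `γ ∈ SL(2,ℤ)`, `E₂(γ·i) ≠ 0` and `E₂(γ·α) ≠ 0`. -/
theorem E2_ne_zero_at_elliptic (γ : SL2Z) :
    E2 (acts γ Complex.I) ≠ 0 ∧ E2 (acts γ alphaPt) ≠ 0 := by
  constructor
  · apply E2_ne_zero_aux γ UpperHalfPlane.I
    have h := E2_transform ⟨!![0, -1; 1, 0], by simp⟩ UpperHalfPlane.I
    simp only [acts, UpperHalfPlane.coe_I] at h ⊢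
    simp at h ⊢
    linear_combination Complex.I * h - (6 * Complex.I / Real.pi) * Complex.I_sq
  · apply E2_ne_zero_aux γ ⟨alphaPt, alpha_im⟩
    have h := E2_transform ⟨!![0, -1; 1, 1], by simp⟩ ⟨alphaPt, alpha_im⟩
    have hq := alpha_sq
    have hf : acts ⟨!![0, -1; 1, 1], by simp⟩ alphaPt = alphaPt := by
      have : alphaPt + 1 ≠ 0 := by
        intro h
        have h1 := congrArg Complex.im h
        have h2 := alpha_im
        simp at h1
        linarith
      simp [acts]
      field_simp
      linear_combination -hq
    simp only at h ⊢
    rw [hf] at h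
    rw [alpha_conj]
    simp at h ⊢
    generalize alphaPt = a at *
    generalize E2 a = e at *
    have h3 : a ^ 3 = 1 := by linear_combination (a - 1) * hq
    have hw : a + 1 = - a ^ 2 := by linear_combination hq
    rw [hw] at h
    generalize 6 * Complex.I / (Real.pi : ℂ) = k at *
    linear_combination a * h + (k + e * a ^ 2) * h3 + e * hq
end
end

section
/- With D := (1/2πi) d/dτ, the Eisenstein series satisfy, for all τ ∈ ℍ: D E₂ = (E₂² − E₄)/12, D E₄ = (E₂E₄ − E₆)/3, and D E₆ = (E₂E₆ − E₄²)/2. In particular the ring ℂ[E₂,E₄,E₆] of quasimodular forms for SL(2,ℤ) is closed under differentiation. -/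
open Complex

noncomputable section

/-- `E₄(τ) = 1 + 240 ∑_{n≥1} σ₃(n) qⁿ`. -/
def E4 (τ : ℂ) : ℂ := 1 + 240 * ∑' n : ℕ, (sigmaFn 3 (n + 1) : ℂ) * qp τ ((n : ℂ) + 1)

/-- `E₆(τ) = 1 − 504 ∑_{n≥1} σ₅(n) qⁿ`. -/
def E6 (τ : ℂ) : ℂ := 1 - 504 * ∑' n : ℕ, (sigmaFn 5 (n + 1) : ℂ) * qp τ ((n : ℂ) + 1)

section Aux

open UpperHalfPlane hiding I
open Complex ModularForm EisensteinSeries Derivative Filter MatrixGroups Manifold Topology CongruenceSubgroup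

/-- The basic divisor-power series. -/
def sser (k : ℕ) (τ : ℂ) : ℂ := ∑' n : ℕ, (sigmaFn k (n + 1) : ℂ) * qp τ ((n : ℂ) + 1)

lemma qp_succ (τ : ℂ) (n : ℕ) :
    qp τ ((n : ℂ) + 1) = cexp (2 * Real.pi * Complex.I * τ) ^ (n + 1) := by
  rw [qp, ← Complex.exp_nat_mul]
  congr 1
  push_cast
  ring

lemma sigmaFn_eq (k n : ℕ) : sigmaFn k n = ArithmeticFunction.sigma k n := by
  simp [sigmaFn, ArithmeticFunction.sigma_apply]

lemma sser_eq (k : ℕ) (z : ℍ) :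
    ∑' n : ℕ+, (ArithmeticFunction.sigma k n : ℂ) * cexp (2 * Real.pi * Complex.I * z) ^ (n : ℕ)
      = sser k z := by
  rw [tsum_pnat_eq_tsum_succ
    (f := fun n ↦ (ArithmeticFunction.sigma k n : ℂ) * cexp (2 * Real.pi * Complex.I * z) ^ n)]
  simp only [sser, qp_succ, sigmaFn_eq]

lemma E2_coe (z : ℍ) : EisensteinSeries.E2 z = _root_.E2 z := by
  rw [EisensteinSeries.E2_eq_tsum_cexp, sser_eq]
  rfl

lemma E4_coe (z : ℍ) : E₄ z = _root_.E4 z := by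
  have h := EisensteinSeries.q_expansion_bernoulli (k := 4) (by norm_num) ⟨2, rfl⟩ z
  simp only [zpow_natCast] at h
  rw [h, sser_eq, show bernoulli 4 = -1 / 30 by decide +kernel]
  simp only [_root_.E4, sser]
  norm_num

lemma E6_coe (z : ℍ) : E₆ z = _root_.E6 z := by
  have h := EisensteinSeries.q_expansion_bernoulli (k := 6) (by norm_num) ⟨3, rfl⟩ z
  simp only [zpow_natCast] at h
  rw [h, sser_eq, show bernoulli 6 = 1 / 42 by decide +kernel]
  simp only [_root_.E6, sser]
  norm_num

lemma sser_tendsto (k : ℕ) : Tendsto (fun z : ℍ ↦ sser k z) atImInfty (𝓝 0) := by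
  have hI := EisensteinSeries.summable_sigma_mul_cexp_pow (k := k + 1) (by omega) UpperHalfPlane.I
  have hI' := ((summable_nat_add_iff 1).mpr hI).norm
  have key : Tendsto (fun z : ℍ ↦ ∑' n : ℕ, (sigmaFn k (n + 1) : ℂ) * qp z ((n : ℂ) + 1))
      atImInfty (𝓝 (∑' n : ℕ, (0 : ℂ))) := by
    refine tendsto_tsum_of_dominated_convergence hI' ?_ ?_
    · intro n
      rw [← mul_zero (sigmaFn k (n + 1) : ℂ)]
      refine Tendsto.const_mul _ ?_
      simp only [qp_succ]
      have h1 : Tendsto (fun z : ℍ ↦ cexp (2 * Real.pi * Complex.I * z)) atImInfty (𝓝 0) := by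
        rw [Complex.tendsto_exp_nhds_zero_iff]
        have : (fun z : ℍ ↦ (2 * Real.pi * Complex.I * (z : ℂ)).re)
            = fun z : ℍ ↦ -(2 * Real.pi * z.im) := by
          ext z; simp
        rw [this]
        exact tendsto_neg_atTop_atBot.comp
          (Tendsto.const_mul_atTop (by positivity) tendsto_comap)
      simpa using h1.pow (n + 1)
    · have : ∀ᶠ z : ℍ in atImInfty, 1 ≤ z.im := (tendsto_comap (f := UpperHalfPlane.im)).eventually_ge_atTop 1
      filter_upwards [this] with z hz n
      rw [qp_succ, sigmaFn_eq, norm_mul, norm_mul, norm_pow, norm_pow]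
      simp only [Nat.add_sub_cancel]
      gcongr
      rw [Complex.norm_exp, Complex.norm_exp]
      apply Real.exp_le_exp.mpr
      have := Real.pi_pos
      simp
      nlinarith
  simpa [sser] using key

lemma E2_tendsto : Tendsto EisensteinSeries.E2 atImInfty (𝓝 1) := by
  have : EisensteinSeries.E2 = fun z : ℍ ↦ 1 - 24 * sser 1 z := by
    ext z; rw [E2_coe]; rfl
  rw [this]
  simpa using ((sser_tendsto 1).const_mul 24).const_sub 1

lemma E4_tendsto : Tendsto E₄ atImInfty (𝓝 1) := by
  have : (E₄ : ℍ → ℂ) = fun z : ℍ ↦ 1 + 240 * sser 3 z := by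
    ext z; rw [E4_coe]; rfl
  rw [this]
  simpa using ((sser_tendsto 3).const_mul 240).const_add 1

lemma E6_tendsto : Tendsto E₆ atImInfty (𝓝 1) := by
  have : (E₆ : ℍ → ℂ) = fun z : ℍ ↦ 1 - 504 * sser 5 z := by
    ext z; rw [E6_coe]; rfl
  rw [this]
  simpa using ((sser_tendsto 5).const_mul 504).const_sub 1

lemma D_tendsto {F : ℍ → ℂ} (hF : MDiff F) {c : ℂ} (h : Tendsto F atImInfty (𝓝 c)) :
    Tendsto (normalizedDerivOfComplex F) atImInfty (𝓝 0) := by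
  have hd : Tendsto (fun z : ℍ ↦ deriv (F ∘ ofComplex) z) atImInfty (𝓝 0) := by
    rw [Metric.tendsto_nhds]
    intro ε hε
    have h1 := (Metric.tendsto_nhds.mp h) (ε / 2) (by positivity)
    obtain ⟨A, hA⟩ := (UpperHalfPlane.atImInfty_mem _).mp h1
    have : ∀ᶠ z : ℍ in atImInfty, max A 0 + 2 ≤ z.im :=
      (tendsto_comap (f := UpperHalfPlane.im)).eventually_ge_atTop _
    filter_upwards [this] with z hz
    have him : ∀ w ∈ Metric.closedBall (z : ℂ) 1, max A 0 + 1 ≤ w.im := by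
      intro w hw
      have h2 := Complex.abs_im_le_norm (w - z)
      rw [Metric.mem_closedBall, dist_eq_norm] at hw
      have h3 := (abs_le.mp (h2.trans hw)).1
      simp at h3
      linarith
    have hpos : ∀ w ∈ Metric.closedBall (z : ℂ) 1, 0 < w.im := fun w hw ↦ by
      have := him w hw
      have := le_max_right A 0
      linarith
    have hdiff : DifferentiableOn ℂ (F ∘ ofComplex) (Metric.closedBall (z : ℂ) 1) :=
      (UpperHalfPlane.mdifferentiable_iff.mp hF).mono hpos
    have hb := Complex.norm_deriv_le_of_forall_mem_sphere_norm_le (f := fun w ↦ (F ∘ ofComplex) w - c)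
      (c := (z : ℂ)) (R := 1) (C := ε / 2) one_pos
      (DifferentiableOn.diffContOnCl (by
        rw [closure_ball _ one_ne_zero]
        exact hdiff.sub_const c)) (by
        intro w hw
        have hw' := Metric.sphere_subset_closedBall hw
        have h5 := hA ⟨w, hpos w hw'⟩ (by
          have := him w hw'
          have := le_max_left A 0
          change A ≤ w.im
          linarith)
        simp only [Function.comp_apply, ofComplex_apply_of_im_pos (hpos w hw')]
        exact (dist_eq_norm (F _) c ▸ h5 : ‖_‖ < ε / 2).le)
    rw [deriv_sub_const] at hb
    rw [dist_zero_right]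
    linarith
  have h9 := hd.const_mul ((2 * Real.pi * Complex.I : ℂ)⁻¹)
  rw [mul_zero] at h9
  exact h9

lemma vanish {k : ℤ} (hk : k < 12) {F : ℍ → ℂ} (hF : MDiff F)
    (hs : ∀ γ : SL(2, ℤ), F ∣[k] γ = F) (h0 : Tendsto F atImInfty (𝓝 0)) : F = 0 := by
  let f : CuspForm 𝒮ℒ k :=
    { toFun := F
      slash_action_eq' := fun _ ⟨γ, hγ⟩ ↦ hγ ▸ hs γ
      holo' := hF
      zero_at_cusps' := fun {c} hc ↦ by
        rw [Subgroup.IsArithmetic.isCusp_iff_isCusp_SL2Z] at hc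
        rw [OnePoint.isZeroAt_iff_forall_SL2Z hc]
        intro γ _
        rw [hs γ]
        exact h0 }
  have h := rank_zero_iff_forall_zero.mp (CuspForm.rank_eq_zero_of_weight_lt_twelve hk) f
  have h2 : (f : ℍ → ℂ) = 0 := by rw [h]; rfl
  exact h2

lemma slash_form {k : ℤ} (f : ModularForm 𝒮ℒ k) (γ : SL(2, ℤ)) : (f : ℍ → ℂ) ∣[k] γ = f :=
  SlashInvariantFormClass.slash_action_eq f _ ⟨γ, rfl⟩

lemma D2_mdiff (γ : SL(2, ℤ)) : MDiff (EisensteinSeries.D2 γ) := by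
  have h : MDiff ((2 * Real.pi * Complex.I * γ 1 0 : ℂ) •
      fun z : ℍ ↦ (denom (γ : GL (Fin 2) ℝ) z)⁻¹) :=
    (mdifferentiable_inv_denom (γ : GL (Fin 2) ℝ)).const_smul _
  exact h

lemma D_D2 (γ : SL(2, ℤ)) (z : ℍ) : normalizedDerivOfComplex (EisensteinSeries.D2 γ) z =
    -((γ 1 0 : ℂ) / denom γ z) ^ 2 := by
  have h := (hasDerivAt_denom_zpow (γ : GL (Fin 2) ℝ) (-1) z).const_mul
    (2 * Real.pi * Complex.I * γ 1 0 : ℂ)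
  have he : (EisensteinSeries.D2 γ ∘ ofComplex) =ᶠ[𝓝 ↑z]
      fun w ↦ (2 * Real.pi * Complex.I * γ 1 0 : ℂ) * denom (γ : GL (Fin 2) ℝ) w ^ (-1 : ℤ) := by
    filter_upwards [isOpen_upperHalfPlaneSet.mem_nhds z.im_pos] with w hw
    simp [EisensteinSeries.D2, ofComplex_apply_of_im_pos hw, div_eq_mul_inv]
  rw [normalizedDerivOfComplex, (h.congr_of_eventuallyEq he).deriv]
  have hz := denom_ne_zero (γ : GL (Fin 2) ℝ) z
  have hpi : (Real.pi : ℂ) ≠ 0 := by exact_mod_cast Real.pi_ne_zero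
  rw [show (-1 - 1 : ℤ) = -2 by norm_num, zpow_neg, zpow_ofNat]
  simp
  field_simp
  rw [Complex.I_sq]
  ring

lemma E2_serre_slash (γ : SL(2, ℤ)) :
    (normalizedDerivOfComplex EisensteinSeries.E2
      - (12⁻¹ : ℂ) • (EisensteinSeries.E2 * EisensteinSeries.E2)) ∣[(4 : ℤ)] γ =
    normalizedDerivOfComplex EisensteinSeries.E2
      - (12⁻¹ : ℂ) • (EisensteinSeries.E2 * EisensteinSeries.E2) := by
  have hE := E2_mdifferentiable
  have hpi : (Real.pi : ℂ) ≠ 0 := by exact_mod_cast Real.pi_ne_zero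
  ext z
  have hz := denom_ne_zero (γ : GL (Fin 2) ℝ) z
  have h1 := congrFun (normalizedDerivOfComplex_SL_slash (k := 2) hE (γ := γ)) z
  have h2 := ModularForm.mul_slash_SL2 2 2 γ EisensteinSeries.E2 EisensteinSeries.E2
  rw [EisensteinSeries.E2_slash_action, normalizedDerivOfComplex_sub _ _ hE
    ((D2_mdiff γ).const_smul _), normalizedDerivOfComplex_smul _ _ (D2_mdiff γ)] at h1
  rw [EisensteinSeries.E2_slash_action, show (2 + 2 : ℤ) = 4 by norm_num] at h2
  rw [show (2 + 2 : ℤ) = 4 by norm_num] at h1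
  rw [sub_eq_add_neg, SlashAction.add_slash, SlashAction.neg_slash, ModularForm.SL_smul_slash, h2]
  simp only [Pi.add_apply, Pi.sub_apply, Pi.smul_apply, Pi.mul_apply, Pi.neg_apply, smul_eq_mul,
    D_D2, riemannZeta_two, EisensteinSeries.D2] at h1 ⊢
  rw [eq_sub_iff_add_eq] at h1
  rw [← h1]
  have hI : Complex.I ^ 2 = -1 := Complex.I_sq
  have hI3 : Complex.I ^ 3 = -Complex.I := Complex.I_pow_three
  push_cast
  field_simp
  ring_nf
  simp only [hI, hI3]
  ring

lemma ram2 : normalizedDerivOfComplex EisensteinSeries.E2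
      - (12⁻¹ : ℂ) • (EisensteinSeries.E2 * EisensteinSeries.E2) + (12⁻¹ : ℂ) • (E₄ : ℍ → ℂ) = 0 := by
  have hE := E2_mdifferentiable
  refine vanish (k := 4) (by norm_num) ?_ ?_ ?_
  · exact ((normalizedDerivOfComplex_mdifferentiable hE).sub ((hE.mul hE).const_smul _)).add
      (E₄.holo'.const_smul _)
  · intro γ
    rw [SlashAction.add_slash, E2_serre_slash, ModularForm.SL_smul_slash]
    rw [slash_form E₄ γ]
  · have := ((D_tendsto hE E2_tendsto).sub ((E2_tendsto.mul E2_tendsto).const_mul 12⁻¹)).add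
      (E4_tendsto.const_mul 12⁻¹)
    rw [show (0 : ℂ) - 12⁻¹ * (1 * 1) + 12⁻¹ * 1 = 0 by norm_num] at this
    exact this

lemma ram4 : serreDerivative (4 : ℤ) E₄ + (3⁻¹ : ℂ) • (E₆ : ℍ → ℂ) = 0 := by
  refine vanish (k := 6) (by norm_num) ?_ ?_ ?_
  · exact (serreDerivative_mdifferentiable _ E₄.holo').add (E₆.holo'.const_smul _)
  · intro γ
    rw [SlashAction.add_slash, ModularForm.SL_smul_slash, slash_form E₆ γ]
    have h1 := serreDerivative_slash_invariant E₄.holo' (slash_form E₄ γ)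
    exact congrArg (· + _) h1
  · have := ((D_tendsto E₄.holo' E4_tendsto).sub ((E2_tendsto.const_mul (((4 : ℤ) : ℂ) * 12⁻¹)).mul E4_tendsto)).add
      (E6_tendsto.const_mul 3⁻¹)
    rw [show (0 : ℂ) - ((4 : ℤ) : ℂ) * 12⁻¹ * 1 * 1 + 3⁻¹ * 1 = 0 by norm_num] at this
    exact this

lemma ram6 : serreDerivative (6 : ℤ) E₆ + (2⁻¹ : ℂ) • ((E₄ : ℍ → ℂ) * E₄) = 0 := by
  refine vanish (k := 8) (by norm_num) ?_ ?_ ?_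
  · exact (serreDerivative_mdifferentiable _ E₆.holo').add ((E₄.holo'.mul E₄.holo').const_smul _)
  · intro γ
    rw [SlashAction.add_slash, ModularForm.SL_smul_slash]
    have h1 := serreDerivative_slash_invariant E₆.holo' (slash_form E₆ γ)
    have h2 := ModularForm.mul_slash_SL2 4 4 γ E₄ E₄
    rw [slash_form E₄ γ] at h2
    exact congrArg₂ (fun a b ↦ a + (2⁻¹ : ℂ) • b) h1 h2
  · have := ((D_tendsto E₆.holo' E6_tendsto).sub
      ((E2_tendsto.const_mul (((6 : ℤ) : ℂ) * 12⁻¹)).mul E6_tendsto)).add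
      ((E4_tendsto.mul E4_tendsto).const_mul 2⁻¹)
    rw [show (0 : ℂ) - ((6 : ℤ) : ℂ) * 12⁻¹ * 1 * 1 + 2⁻¹ * (1 * 1) = 0 by norm_num] at this
    exact this

lemma nderiv_eq {f : ℂ → ℂ} {F : ℍ → ℂ} (h : ∀ z : ℍ, F z = f z) (z : ℍ) :
    normalizedDerivOfComplex F z = 1 / (2 * (Real.pi : ℂ) * Complex.I) * deriv f z := by
  rw [normalizedDerivOfComplex, one_div]
  congr 1
  apply Filter.EventuallyEq.deriv_eq
  filter_upwards [isOpen_upperHalfPlaneSet.mem_nhds z.im_pos] with w hw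
  simp [ofComplex_apply_of_im_pos hw, h]

end Aux

/-- Ramanujan's identities: with `D = (1/2πi) d/dτ`, for all `τ ∈ ℍ`,
`D E₂ = (E₂² − E₄)/12`, `D E₄ = (E₂E₄ − E₆)/3`, `D E₆ = (E₂E₆ − E₄²)/2`. -/
theorem ramanujan_identities (τ : ℂ) (hτ : 0 < τ.im) :
    (1 / (2 * (Real.pi : ℂ) * Complex.I)) * deriv E2 τ = (E2 τ ^ 2 - E4 τ) / 12 ∧
    (1 / (2 * (Real.pi : ℂ) * Complex.I)) * deriv E4 τ = (E2 τ * E4 τ - E6 τ) / 3 ∧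
    (1 / (2 * (Real.pi : ℂ) * Complex.I)) * deriv E6 τ = (E2 τ * E6 τ - E4 τ ^ 2) / 2 := by

  have h2 := congrFun ram2 ⟨τ, hτ⟩
  have h4 := congrFun ram4 ⟨τ, hτ⟩
  have h6 := congrFun ram6 ⟨τ, hτ⟩
  simp only [Pi.add_apply, Pi.sub_apply, Pi.smul_apply, Pi.mul_apply, Pi.zero_apply, smul_eq_mul,
    Derivative.serreDerivative_apply, nderiv_eq E2_coe, nderiv_eq E4_coe, nderiv_eq E6_coe,
    E2_coe, E4_coe, E6_coe] at h2 h4 h6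
  push_cast at h4 h6
  refine ⟨?_, ?_, ?_⟩
  · linear_combination h2
  · linear_combination h4
  · linear_combination h6
end
end

section
/- With D := (1/2πi) d/dτ, the fourth powers of the Jacobi theta constants satisfy, for all τ ∈ ℍ: D θ₂(τ)⁴ = (1/6) θ₂(τ)⁴ (E₂(τ) + θ₃(τ)⁴ + θ₄(τ)⁴), D θ₃(τ)⁴ = (1/6) θ₃(τ)⁴ (E₂(τ) + θ₂(τ)⁴ − θ₄(τ)⁴), and D θ₄(τ)⁴ = (1/6) θ₄(τ)⁴ (E₂(τ) − θ₂(τ)⁴ − θ₃(τ)⁴). -/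
open Complex

noncomputable section

/-- Jacobi theta constant `θ₂(τ) = ∑_{r∈ℤ+1/2} q^{r²/2}`. -/
def theta2 (τ : ℂ) : ℂ := ∑' n : ℤ, qp τ (((n : ℂ) + 1 / 2) ^ 2 / 2)

/-- Jacobi theta constant `θ₃(τ) = ∑_{n∈ℤ} q^{n²/2}`. -/
def theta3 (τ : ℂ) : ℂ := ∑' n : ℤ, qp τ ((n : ℂ) ^ 2 / 2)

/-- Jacobi theta constant `θ₄(τ) = ∑_{n∈ℤ} (−1)ⁿ q^{n²/2}`. -/
def theta4 (τ : ℂ) : ℂ := ∑' n : ℤ, (-1 : ℂ) ^ n * qp τ ((n : ℂ) ^ 2 / 2)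

section helpers

open UpperHalfPlane hiding I
open Filter Asymptotics Derivative
open scoped Real Topology Manifold MatrixGroups ModularForm

lemma th3_eq (τ : ℂ) : theta3 τ = jacobiTheta τ := by
  unfold theta3 jacobiTheta qp
  refine tsum_congr fun n => ?_
  congr 1; ring

lemma th3_eq' (τ : ℂ) : theta3 τ = jacobiTheta₂ 0 τ := by
  rw [th3_eq, jacobiTheta_eq_jacobiTheta₂]

lemma exp_pi_int (n : ℤ) : cexp (π * I * n) = (-1 : ℂ) ^ n := by
  rw [mul_comm, Complex.exp_int_mul, Complex.exp_pi_mul_I]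

lemma th4_eq (τ : ℂ) : theta4 τ = jacobiTheta₂ (1 / 2) τ := by
  unfold theta4 jacobiTheta₂ jacobiTheta₂_term qp
  refine tsum_congr fun n => ?_
  rw [← exp_pi_int, ← Complex.exp_add]
  congr 1; ring

lemma th2_eq (τ : ℂ) : theta2 τ = cexp (π * I * τ / 4) * jacobiTheta₂ (τ / 2) τ := by
  unfold theta2 jacobiTheta₂ jacobiTheta₂_term qp
  rw [← tsum_mul_left]
  refine tsum_congr fun n => ?_
  rw [← Complex.exp_add]
  congr 1; ring

lemma exp_pi_int_sq (n : ℤ) : cexp (π * I * n ^ 2) = cexp (π * I * n) := by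
  have h := exp_pi_int (n ^ 2)
  push_cast at h
  rw [h, exp_pi_int]
  rcases Int.even_or_odd n with h | h
  · rw [h.neg_one_zpow, (h.pow_of_ne_zero two_ne_zero).neg_one_zpow]
  · rw [h.neg_one_zpow, h.pow.neg_one_zpow]

lemma th3_T (τ : ℂ) : theta3 (1 + τ) = theta4 τ := by
  rw [th3_eq', th4_eq]
  unfold jacobiTheta₂ jacobiTheta₂_term
  refine tsum_congr fun n => ?_
  have : (2 * π * I * n * 0 + π * I * n ^ 2 * (1 + τ) : ℂ) =
    π * I * n ^ 2 + π * I * n ^ 2 * τ := by ring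
  rw [this, Complex.exp_add, exp_pi_int_sq, ← Complex.exp_add]
  congr 1; ring

lemma th4_T (τ : ℂ) : theta4 (1 + τ) = theta3 τ := by
  rw [← th3_T, th3_eq', th3_eq', ← jacobiTheta₂_add_right 0 τ]
  congr 1; ring

lemma th2_T (τ : ℂ) : theta2 (1 + τ) ^ 4 = - theta2 τ ^ 4 := by
  have : theta2 (1 + τ) = cexp (π * I / 4) * theta2 τ := by
    unfold theta2 qp
    rw [← tsum_mul_left]
    refine tsum_congr fun n => ?_
    have : (2 * π * I * (1 + τ) * ((n + 1 / 2) ^ 2 / 2) : ℂ) =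
      π * I * n ^ 2 + (π * I * n + (π * I / 4 + 2 * π * I * τ * ((n + 1 / 2) ^ 2 / 2))) := by ring
    rw [this, Complex.exp_add, exp_pi_int_sq, ← Complex.exp_add]
    have : (π * I * n + (π * I * n + (π * I / 4 + 2 * π * I * τ * ((n + 1 / 2) ^ 2 / 2))) : ℂ) =
      n * (2 * π * I) + (π * I / 4 + 2 * π * I * τ * ((n + 1 / 2) ^ 2 / 2)) := by ring
    rw [this, Complex.exp_add, Complex.exp_int_mul_two_pi_mul_I, one_mul, Complex.exp_add]
  rw [this, mul_pow, ← Complex.exp_nat_mul]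
  have : ((4 : ℕ) * (π * I / 4) : ℂ) = π * I := by push_cast; ring
  rw [this, Complex.exp_pi_mul_I]; ring

lemma cpow_half_four (τ : ℂ) (_h : τ ≠ 0) : (((-I * τ) ^ (1 / 2 : ℂ)) ^ 4) = - τ ^ 2 := by
  rw [← Complex.cpow_nat_mul]
  have : (((4 : ℕ) : ℂ) * (1 / 2)) = ((2 : ℕ) : ℂ) := by norm_num
  rw [this, Complex.cpow_natCast, mul_pow, neg_sq, Complex.I_sq]; ring

lemma cpow_half_ne (τ : ℂ) (h : τ ≠ 0) : ((-I * τ) ^ (1 / 2 : ℂ)) ≠ 0 := by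
  intro h0
  have := cpow_half_four τ h
  rw [h0] at this
  simp at this
  exact h this

lemma th3_S (τ : ℂ) (h : τ ≠ 0) : theta3 (-1 / τ) ^ 4 = - τ ^ 2 * theta3 τ ^ 4 := by
  have := jacobiTheta₂_functional_equation 0 τ
  rw [th3_eq', th3_eq', this]
  simp only [mul_pow, div_pow, cpow_half_four τ h]
  simp
  field_simp

lemma th4_S (τ : ℂ) (h : τ ≠ 0) : theta2 (-1 / τ) ^ 4 = - τ ^ 2 * theta4 τ ^ 4 := by
  have := jacobiTheta₂_functional_equation (1 / 2) τ
  have h1 : jacobiTheta₂ (1 / 2 / τ) (-1 / τ) = jacobiTheta₂ (-1 / τ / 2) (-1 / τ) := by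
    rw [← jacobiTheta₂_neg_left]; congr 1; field_simp
  have h2 : (-π * I * (1 / 2) ^ 2 / τ : ℂ) = π * I * (-1 / τ) / 4 := by field_simp; norm_num
  rw [h1, h2] at this
  rw [th4_eq, th2_eq, this]
  simp only [mul_pow, div_pow (1 : ℂ) ((-I * τ) ^ (1 / 2 : ℂ)), cpow_half_four τ h]
  field_simp

lemma th2_S (τ : ℂ) (h : τ ≠ 0) : theta4 (-1 / τ) ^ 4 = - τ ^ 2 * theta2 τ ^ 4 := by
  have := th4_S (-1 / τ) (by simpa using h)
  have h1 : -1 / (-1 / τ) = τ := by field_simp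
  rw [h1] at this
  rw [this]
  field_simp

lemma th3_diff {τ : ℂ} (h : 0 < τ.im) : DifferentiableAt ℂ theta3 τ := by
  rw [funext th3_eq]; exact differentiableAt_jacobiTheta h

lemma th4_diff {τ : ℂ} (h : 0 < τ.im) : DifferentiableAt ℂ theta4 τ := by
  rw [funext th4_eq]; exact differentiableAt_jacobiTheta₂_snd _ h

lemma th2_diff {τ : ℂ} (h : 0 < τ.im) : DifferentiableAt ℂ theta2 τ := by
  rw [funext th2_eq]
  refine DifferentiableAt.mul (by fun_prop) ?_
  have := (hasFDerivAt_jacobiTheta₂ (τ / 2) h).differentiableAt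
  exact DifferentiableAt.comp (f := fun t : ℂ => (t / 2, t)) τ this (by fun_prop)

/-- decay rate -/
def er (z : ℍ) : ℝ := rexp (-π * z.im)

lemma er_pos (z : ℍ) : 0 < er z := Real.exp_pos _

def tA (z : ℍ) : ℂ := theta2 z ^ 4
def tB (z : ℍ) : ℂ := theta3 z ^ 4
def tC (z : ℍ) : ℂ := theta4 z ^ 4

lemma mdiff_of {f : ℂ → ℂ} (hf : ∀ τ : ℂ, 0 < τ.im → DifferentiableAt ℂ f τ) :
    MDiff (fun z : ℍ => f z) := by
  rw [UpperHalfPlane.mdifferentiable_iff]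
  refine DifferentiableOn.congr (f := f) (fun z hz => (hf z hz).differentiableWithinAt) ?_
  intro z hz
  simp [ofComplex_apply_of_im_pos hz]

lemma tA_md : MDiff tA := mdiff_of (f := fun t => theta2 t ^ 4) fun _ h => (th2_diff h).pow 4
lemma tB_md : MDiff tB := mdiff_of (f := fun t => theta3 t ^ 4) fun _ h => (th3_diff h).pow 4
lemma tC_md : MDiff tC := mdiff_of (f := fun t => theta4 t ^ 4) fun _ h => (th4_diff h).pow 4

lemma er_bdd : er =O[atImInfty] (fun _ => (1 : ℝ)) := by
  refine IsBigO.of_bound 1 (Eventually.of_forall fun z => ?_)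
  rw [Real.norm_of_nonneg (er_pos z).le]
  simp only [er, norm_one, mul_one]
  refine Real.exp_le_one_iff.mpr ?_
  have := mul_pos Real.pi_pos z.im_pos
  linarith

lemma pow4_bigO {f : ℍ → ℂ} (h : (fun z => f z - 1) =O[atImInfty] er) :
    (fun z => f z ^ 4 - 1) =O[atImInfty] er := by
  have h1 : f =O[atImInfty] (fun _ => (1 : ℝ)) := by
    have := (h.trans er_bdd).add (isBigO_const_const (1 : ℂ) (one_ne_zero (α := ℝ)) atImInfty)
    simpa using this
  have h2 : (fun z => f z ^ 3 + f z ^ 2 + f z + 1) =O[atImInfty] (fun _ => (1 : ℝ)) := by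
    have a3 := h1.pow 3
    have a2 := h1.pow 2
    simp only [one_pow] at a3 a2
    exact ((a3.add a2).add h1).add (isBigO_const_const (1 : ℂ) (one_ne_zero (α := ℝ)) atImInfty)
  have := h.mul h2
  simp only [mul_one] at this
  refine this.congr_left fun z => by ring

lemma th3_bound {τ : ℂ} (h : 1 ≤ τ.im) :
    ‖theta3 τ - 1‖ ≤ 2 / (1 - rexp (-π)) * rexp (-π * τ.im) := by
  rw [th3_eq]
  refine (norm_jacobiTheta_sub_one_le (by linarith)).trans ?_
  have h1 : rexp (-π * τ.im) ≤ rexp (-π) := by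
    apply Real.exp_le_exp.mpr; nlinarith [Real.pi_pos]
  have h2 : rexp (-π) < 1 := by
    apply Real.exp_lt_one_iff.mpr; linarith [Real.pi_pos]
  have h3 : 0 < 1 - rexp (-π) := by linarith
  gcongr

lemma ev_im (c : ℝ) : ∀ᶠ z : ℍ in atImInfty, c ≤ z.im := by
  rw [atImInfty]
  exact (eventually_ge_atTop c).comap _

lemma tB_bigO : (fun z => tB z - 1) =O[atImInfty] er := by
  refine pow4_bigO (f := fun z => theta3 z) (IsBigO.of_bound (2 / (1 - rexp (-π))) ?_)
  filter_upwards [ev_im 1] with z hz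
  rw [Real.norm_of_nonneg (er_pos z).le]
  exact th3_bound hz

lemma tC_bigO : (fun z => tC z - 1) =O[atImInfty] er := by
  refine pow4_bigO (f := fun z => theta4 z) (IsBigO.of_bound (2 / (1 - rexp (-π))) ?_)
  filter_upwards [ev_im 1] with z hz
  rw [Real.norm_of_nonneg (er_pos z).le, ← th3_T]
  have := th3_bound (τ := 1 + z) (by simpa using hz)
  simpa [er] using this

lemma norm_qp (τ : ℂ) (s : ℝ) : ‖qp τ s‖ = rexp (-2 * π * τ.im * s) := by
  unfold qp
  rw [Complex.norm_exp]
  congr 1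
  have : (2 * π * I * τ * s : ℂ) = ((2 * π * s : ℝ) : ℂ) * (I * τ) := by push_cast; ring
  rw [this, Complex.re_ofReal_mul]
  simp
  ring

lemma tA_bigO : tA =O[atImInfty] er := by
  let K : ℝ := ∑' n : ℤ, ‖jacobiTheta₂_term n (I / 2) I‖
  have hs : Summable fun n : ℤ => ‖jacobiTheta₂_term n (I / 2) I‖ :=
    ((summable_jacobiTheta₂_term_iff (I / 2) I).mpr (by simp)).norm
  refine IsBigO.of_bound (K ^ 4) ?_
  filter_upwards [ev_im 1] with z hz
  rw [Real.norm_of_nonneg (er_pos z).le]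
  have hK : ‖jacobiTheta₂ ((z : ℂ) / 2) z‖ ≤ K := by
    refine tsum_of_norm_bounded hs.hasSum fun n => ?_
    rw [norm_jacobiTheta₂_term, norm_jacobiTheta₂_term]
    apply Real.exp_le_exp.mpr
    have e1 : ((z : ℂ) / 2).im = z.im / 2 := by simp
    have e2 : (I / 2).im = 1 / 2 := by simp
    rw [e1, e2, Complex.I_im, UpperHalfPlane.coe_im]
    have hn : (0 : ℝ) ≤ n ^ 2 + n := by
      have : (0 : ℤ) ≤ n ^ 2 + n := by
        rcases le_or_gt 0 n with h | h <;> nlinarith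
      exact_mod_cast this
    nlinarith [mul_nonneg (mul_nonneg Real.pi_pos.le hn) (sub_nonneg.mpr hz)]
  have h1 : ‖cexp (π * I * z / 4)‖ ^ 4 = er z := by
    rw [← norm_pow, ← Complex.exp_nat_mul, Complex.norm_exp, er]
    congr 1
    have : ((4 : ℕ) * (π * I * z / 4) : ℂ) = (π : ℂ) * (I * z) := by push_cast; ring
    rw [this, Complex.re_ofReal_mul]
    simp
  simp only [tA, th2_eq, norm_pow, norm_mul, mul_pow, h1]
  rw [mul_comm]
  gcongr
  exact (er_pos z).le

lemma E2_eq (z : ℍ) : EisensteinSeries.E2 z = E2 z := by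
  rw [EisensteinSeries.E2_eq_tsum_cexp, E2]
  congr 2
  rw [tsum_pnat_eq_tsum_succ
    (f := fun n : ℕ => (ArithmeticFunction.sigma 1 n : ℂ) * cexp (2 * π * I * z) ^ n)]
  refine tsum_congr fun n => ?_
  rw [sigmaFn, ArithmeticFunction.sigma_apply, qp, ← Complex.exp_nat_mul]
  congr 2
  push_cast; ring

lemma E2_bigO : (fun z : ℍ => EisensteinSeries.E2 z - 1) =O[atImInfty] er := by
  have hs : Summable fun n : ℕ => ‖(ArithmeticFunction.sigma 1 (n + 1) : ℂ) *
      cexp (2 * π * I * (UpperHalfPlane.I : ℍ)) ^ (n + 1)‖ :=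
    ((summable_nat_add_iff 1).mpr
      (EisensteinSeries.summable_sigma_mul_cexp_pow (k := 2) one_le_two UpperHalfPlane.I)).norm
  have hn (z : ℍ) : ‖cexp (2 * π * I * z)‖ = rexp (-2 * π * z.im) := by
    have := norm_qp z 1
    simpa [qp] using this
  set K : ℝ := ∑' n : ℕ, ‖(ArithmeticFunction.sigma 1 (n + 1) : ℂ) *
      cexp (2 * π * I * (UpperHalfPlane.I : ℍ)) ^ (n + 1)‖ with hK
  refine IsBigO.of_bound (24 * (K * rexp (2 * π))) ?_
  filter_upwards [ev_im 1] with z hz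
  rw [Real.norm_of_nonneg (er_pos z).le, EisensteinSeries.E2_eq_tsum_cexp,
    tsum_pnat_eq_tsum_succ
    (f := fun n : ℕ => (ArithmeticFunction.sigma 1 n : ℂ) * cexp (2 * π * I * z) ^ n)]
  have hb : ‖∑' n : ℕ, (ArithmeticFunction.sigma 1 (n + 1) : ℂ) * cexp (2 * π * I * z) ^ (n + 1)‖
      ≤ K * (rexp (2 * π) * er z) := by
    refine tsum_of_norm_bounded (hs.hasSum.mul_right _) fun n => ?_
    rw [norm_mul, norm_mul, norm_pow, norm_pow, hn, hn,
      mul_assoc ‖((ArithmeticFunction.sigma 1 (n + 1) : ℕ) : ℂ)‖]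
    gcongr
    rw [er, ← Real.exp_nat_mul, ← Real.exp_nat_mul, ← Real.exp_add, ← Real.exp_add]
    apply Real.exp_le_exp.mpr
    simp only [UpperHalfPlane.I_im]
    push_cast
    have hp := Real.pi_pos
    have h1 : 0 ≤ π * ((n : ℝ) * (z.im - 1)) := by
      have : 0 ≤ z.im - 1 := by linarith
      positivity
    have h2 : 0 ≤ π * z.im := by have := z.im_pos; positivity
    nlinarith
  have : (1 - 24 * ∑' n : ℕ, (ArithmeticFunction.sigma 1 (n + 1) : ℂ) *
      cexp (2 * π * I * z) ^ (n + 1)) - 1 = -(24 * ∑' n : ℕ,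
      (ArithmeticFunction.sigma 1 (n + 1) : ℂ) * cexp (2 * π * I * z) ^ (n + 1)) := by ring
  rw [this, norm_neg, norm_mul]
  have h24 : ‖(24 : ℂ)‖ = 24 := by simp
  rw [h24]
  linarith

lemma D_bigO {f : ℂ → ℂ} (hf : ∀ τ : ℂ, 0 < τ.im → DifferentiableAt ℂ f τ) (c : ℂ)
    (h : (fun z : ℍ => f z - c) =O[atImInfty] er) :
    (normalizedDerivOfComplex (fun z : ℍ => f z)) =O[atImInfty] er := by
  obtain ⟨M, hM⟩ := h.bound
  rw [atImInfty, Filter.eventually_comap, eventually_atTop] at hM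
  obtain ⟨Y, hY⟩ := hM
  refine IsBigO.of_bound (‖(2 * π * I : ℂ)⁻¹‖ * (M * rexp π)) ?_
  filter_upwards [ev_im (Y + 2), ev_im 2] with z hz hz2
  rw [Real.norm_of_nonneg (er_pos z).le, normalizedDerivOfComplex, norm_mul]
  refine (mul_le_mul_of_nonneg_left (?_ : _ ≤ M * (rexp π * er z)) (norm_nonneg _)).trans_eq (by ring)
  have e1 : deriv ((fun z : ℍ => f z) ∘ ofComplex) z = deriv (fun t => f t - c) z := by
    rw [deriv_sub_const]
    apply Filter.EventuallyEq.deriv_eq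
    filter_upwards [isOpen_upperHalfPlaneSet.mem_nhds z.im_pos] with w hw
    simp [ofComplex_apply_of_im_pos hw]
  rw [e1]
  have key : ∀ w : ℂ, w ∈ Metric.closedBall (z : ℂ) 1 → z.im - 1 ≤ w.im := by
    intro w hw
    have h1 : |(w - z).im| ≤ 1 := (Complex.abs_im_le_norm _).trans (by simpa [dist_eq_norm] using hw)
    rw [Complex.sub_im, UpperHalfPlane.coe_im] at h1
    linarith [(abs_le.mp h1).1]
  have hM0 : 0 ≤ M := by
    have := hY z.im (by linarith) z rfl
    rw [Real.norm_of_nonneg (er_pos z).le] at this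
    by_contra hneg
    push Not at hneg
    have := mul_neg_of_neg_of_pos hneg (er_pos z)
    linarith [norm_nonneg (f z - c)]
  have := Complex.norm_deriv_le_of_forall_mem_sphere_norm_le (f := fun t => f t - c) (c := (z : ℂ))
    (R := 1) (C := M * (rexp π * er z)) one_pos ?_ ?_
  · simpa [mul_assoc] using this
  · refine DifferentiableOn.diffContOnCl ?_
    rw [closure_ball _ one_ne_zero]
    intro w hw
    exact ((hf w (by linarith [key w hw])).sub_const c).differentiableWithinAt
  · intro w hw
    have hk := key w (Metric.sphere_subset_closedBall hw)
    have hw0 : 0 < w.im := by linarith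
    have := hY w.im (by linarith) ⟨w, hw0⟩ rfl
    rw [Real.norm_of_nonneg (er_pos _).le] at this
    refine this.trans ?_
    gcongr
    rw [er, er, ← Real.exp_add]
    apply Real.exp_le_exp.mpr
    change -π * w.im ≤ _
    nlinarith [Real.pi_pos]


lemma tX_T {f g : ℂ → ℂ} (h : ∀ τ, f (1 + τ) = g τ) :
    (fun z : ℍ => f z) ∣[(2 : ℤ)] ModularGroup.T = (fun z : ℍ => g z) := by
  ext z
  have hd : denom ModularGroup.T z = 1 := by
    rw [ModularGroup.denom_apply]; simp [ModularGroup.T]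
  rw [ModularForm.SL_slash_apply, modular_T_smul, hd]
  simp [h]

lemma tX_S {f g : ℂ → ℂ} (h : ∀ τ, τ ≠ 0 → f (-1 / τ) = - τ ^ 2 * g τ) :
    (fun z : ℍ => f z) ∣[(2 : ℤ)] ModularGroup.S = (fun z : ℍ => - g z) := by
  ext z
  have hz := z.ne_zero
  have h1 := h z hz
  rw [ModularForm.SL_slash_apply, modular_S_smul, ModularGroup.denom_S]
  have h2 : ((-(z : ℂ))⁻¹) = -1 / z := by field_simp
  simp only [h2, h1]
  rw [zpow_neg, zpow_ofNat]
  field_simp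

lemma tA_T : tA ∣[(2 : ℤ)] ModularGroup.T = -tA :=
  tX_T (f := fun t => theta2 t ^ 4) (g := fun t => - theta2 t ^ 4) fun τ => by
    simp [th2_T]
lemma tB_T : tB ∣[(2 : ℤ)] ModularGroup.T = tC :=
  tX_T (f := fun t => theta3 t ^ 4) (g := fun t => theta4 t ^ 4) fun τ => by
    simp [th3_T]
lemma tC_T : tC ∣[(2 : ℤ)] ModularGroup.T = tB :=
  tX_T (f := fun t => theta4 t ^ 4) (g := fun t => theta3 t ^ 4) fun τ => by
    simp [th4_T]
lemma tA_S : tA ∣[(2 : ℤ)] ModularGroup.S = -tC :=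
  tX_S (f := fun t => theta2 t ^ 4) (g := fun t => theta4 t ^ 4) th4_S
lemma tB_S : tB ∣[(2 : ℤ)] ModularGroup.S = -tB :=
  tX_S (f := fun t => theta3 t ^ 4) (g := fun t => theta3 t ^ 4) th3_S
lemma tC_S : tC ∣[(2 : ℤ)] ModularGroup.S = -tA :=
  tX_S (f := fun t => theta4 t ^ 4) (g := fun t => theta2 t ^ 4) th2_S

def GG (P X : ℍ → ℂ) : ℍ → ℂ := serreDerivative 2 P - (1 / 6 : ℂ) • (P * X)

lemma GG_neg {P X : ℍ → ℂ} (hP : MDiff P) : GG (-P) X = -GG P X := by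
  have h : -P = (-1 : ℂ) • P := by ext; simp
  have h1 : serreDerivative 2 (-P) = - serreDerivative 2 P := by
    rw [h, serreDerivative_smul _ _ _ hP]; ext; simp
  unfold GG
  rw [h1]
  ext z
  simp only [Pi.sub_apply, Pi.neg_apply, Pi.smul_apply, Pi.mul_apply, smul_eq_mul]
  ring

lemma GG_slash {P X : ℍ → ℂ} (hP : MDiff P) (γ : SL(2, ℤ)) :
    GG P X ∣[(4 : ℤ)] γ = GG (P ∣[(2 : ℤ)] γ) (X ∣[(2 : ℤ)] γ) := by
  have h1 := serreDerivative_slash_equivariant (k := 2) hP (γ := γ)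
  have h2 := ModularForm.mul_slash_SL2 2 2 γ P X
  have h3 : serreDerivative 2 P ∣[(4 : ℤ)] γ = serreDerivative 2 (P ∣[(2 : ℤ)] γ) := by
    have e : (((2 : ℤ)) : ℂ) = 2 := by norm_num
    rw [e] at h1
    exact h1
  norm_num at h2
  unfold GG
  rw [sub_eq_add_neg, SlashAction.add_slash, SlashAction.neg_slash, ModularForm.SL_smul_slash, h2,
    sub_eq_add_neg, h3]

lemma GG_md {P X : ℍ → ℂ} (hP : MDiff P) (hX : MDiff X) : MDiff (GG P X) :=
  (serreDerivative_mdifferentiable 2 hP).sub ((hP.mul hX).const_smul _)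

def g2 := GG tA (tB + tC)
def g3 := GG tB (tA + -tC)
def g4 := GG tC (-tA + -tB)

lemma g2_md : MDiff g2 := GG_md tA_md (tB_md.add tC_md)
lemma g3_md : MDiff g3 := GG_md tB_md (tA_md.add tC_md.neg)
lemma g4_md : MDiff g4 := GG_md tC_md (tA_md.neg.add tB_md.neg)

lemma g2_T : g2 ∣[(4 : ℤ)] ModularGroup.T = -g2 := by
  rw [g2, GG_slash tA_md, SlashAction.add_slash, tA_T, tB_T, tC_T, GG_neg tA_md, add_comm tC]
lemma g3_T : g3 ∣[(4 : ℤ)] ModularGroup.T = g4 := by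
  rw [g3, GG_slash tB_md, SlashAction.add_slash, SlashAction.neg_slash, tA_T, tB_T, tC_T, g4]
lemma g4_T : g4 ∣[(4 : ℤ)] ModularGroup.T = g3 := by
  rw [g4, GG_slash tC_md, SlashAction.add_slash, SlashAction.neg_slash, SlashAction.neg_slash,
    tA_T, tB_T, tC_T, g3, neg_neg]
lemma g2_S : g2 ∣[(4 : ℤ)] ModularGroup.S = -g4 := by
  rw [g2, GG_slash tA_md, SlashAction.add_slash, tA_S, tB_S, tC_S, GG_neg tC_md, add_comm (-tB), g4]
lemma g3_S : g3 ∣[(4 : ℤ)] ModularGroup.S = -g3 := by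
  rw [g3, GG_slash tB_md, SlashAction.add_slash, SlashAction.neg_slash, tA_S, tB_S, tC_S,
    GG_neg tB_md, neg_neg, add_comm (-tC)]
lemma g4_S : g4 ∣[(4 : ℤ)] ModularGroup.S = -g2 := by
  rw [g4, GG_slash tC_md, SlashAction.add_slash, SlashAction.neg_slash, SlashAction.neg_slash,
    tA_S, tB_S, tC_S, g2, neg_neg, neg_neg, GG_neg tA_md, add_comm tC]

lemma bdd_of {f : ℍ → ℂ} (h : (fun z => f z - 1) =O[atImInfty] er) :
    f =O[atImInfty] (fun _ => (1 : ℝ)) := by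
  have := (h.trans er_bdd).add (isBigO_const_const (1 : ℂ) (one_ne_zero (α := ℝ)) atImInfty)
  simpa using this

lemma g2_bigO : g2 =O[atImInfty] er := by
  have h1 : D tA =O[atImInfty] er := D_bigO (f := fun t => theta2 t ^ 4)
    (fun _ h => (th2_diff h).pow 4) 0 (by simp only [sub_zero]; exact tA_bigO)
  have h2 := tA_bigO.mul (((bdd_of E2_bigO).add (bdd_of tB_bigO)).add (bdd_of tC_bigO))
  simp only [mul_one] at h2
  refine (h1.sub (h2.const_mul_left (1 / 6))).congr_left fun z => ?_
  simp only [g2, GG, Pi.sub_apply, Pi.add_apply, Pi.smul_apply, Pi.mul_apply, smul_eq_mul,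
    serreDerivative_apply]
  ring

lemma g3_bigO : g3 =O[atImInfty] er := by
  have h1 : D tB =O[atImInfty] er := D_bigO (f := fun t => theta3 t ^ 4)
    (fun _ h => (th3_diff h).pow 4) 1 tB_bigO
  have h2 := (bdd_of tB_bigO).mul ((E2_bigO.add tA_bigO).sub tC_bigO)
  simp only [one_mul] at h2
  refine (h1.sub (h2.const_mul_left (1 / 6))).congr_left fun z => ?_
  simp only [g3, GG, Pi.sub_apply, Pi.add_apply, Pi.neg_apply, Pi.smul_apply, Pi.mul_apply,
    smul_eq_mul, serreDerivative_apply]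
  ring

lemma g4_bigO : g4 =O[atImInfty] er := by
  have h1 : D tC =O[atImInfty] er := D_bigO (f := fun t => theta4 t ^ 4)
    (fun _ h => (th4_diff h).pow 4) 1 tC_bigO
  have h2 := (bdd_of tC_bigO).mul ((E2_bigO.sub tA_bigO).sub tB_bigO)
  simp only [one_mul] at h2
  refine (h1.sub (h2.const_mul_left (1 / 6))).congr_left fun z => ?_
  simp only [g4, GG, Pi.sub_apply, Pi.add_apply, Pi.neg_apply, Pi.smul_apply, Pi.mul_apply,
    smul_eq_mul, serreDerivative_apply]
  ring

local notation "Δ" => ModularForm.discriminant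

def FF : ℍ → ℂ := g2 * g3 * g4

lemma FF_slash (γ : SL(2, ℤ)) : FF ∣[(12 : ℤ)] γ =
    (g2 ∣[(4 : ℤ)] γ) * (g3 ∣[(4 : ℤ)] γ) * (g4 ∣[(4 : ℤ)] γ) := by
  have h1 := ModularForm.mul_slash_SL2 (4 + 4) 4 γ (g2 * g3) g4
  rw [ModularForm.mul_slash_SL2 4 4 γ g2 g3] at h1
  exact h1

/-- The quotient -/
def HH : ℍ → ℂ := fun z => (FF z / Δ z) ^ 2

lemma HH_slash {γ : SL(2, ℤ)} {ε : ℂ} (he : ε ^ 2 = 1) (h : FF ∣[(12 : ℤ)] γ = ε • FF)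
    (hd : Δ ∣[(12 : ℤ)] γ = Δ) : HH ∣[(0 : ℤ)] γ = HH := by
  ext z
  have h1 := congrFun h z
  have h2 := congrFun hd z
  have hn := denom_ne_zero γ z
  rw [ModularForm.SL_slash_apply] at h1 h2 ⊢
  have d0 := ModularForm.discriminant_ne_zero z
  have hp : denom γ z ^ (-12 : ℤ) ≠ 0 := zpow_ne_zero _ hn
  have hF : FF (γ • z) / Δ (γ • z) = ε * (FF z / Δ z) := by
    rw [← mul_div_mul_right _ _ hp, h1, h2, Pi.smul_apply, smul_eq_mul, mul_div_assoc]
  simp only [HH]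
  rw [hF, mul_pow, he]
  simp

lemma HH_T : HH ∣[(0 : ℤ)] ModularGroup.T = HH := by
  refine HH_slash (ε := -1) (by norm_num) ?_ ModularForm.discriminant_T_invariant
  rw [FF_slash, g2_T, g3_T, g4_T, FF]; ext z; simp; ring

lemma HH_S : HH ∣[(0 : ℤ)] ModularGroup.S = HH := by
  refine HH_slash (ε := -1) (by norm_num) ?_ ModularForm.discriminant_S_invariant
  rw [FF_slash, g2_S, g3_S, g4_S, FF]; ext z; simp; ring

lemma HH_md : MDiff HH := by
  have h1 : MDiff FF := (g2_md.mul g3_md).mul g4_md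
  have h2 : MDiff (fun z => FF z / Δ z) :=
    h1.div CuspForm.discriminant.holo' ModularForm.discriminant_ne_zero
  have e : HH = (fun z => FF z / Δ z) * (fun z => FF z / Δ z) := by
    ext z
    simp [HH, sq]
  rw [e]
  exact h2.mul h2

lemma HH_zero : Tendsto HH atImInfty (𝓝 0) := by
  have h := (g2_bigO.mul g3_bigO).mul g4_bigO
  have he : Tendsto er atImInfty (𝓝 0) := by
    have : Tendsto (fun z : ℍ => -π * z.im) atImInfty atBot :=
      (tendsto_comap (f := UpperHalfPlane.im)).const_mul_atTop_of_neg (by linarith [Real.pi_pos])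
    exact Real.tendsto_exp_atBot.comp this
  have hq : (fun z => FF z / Δ z) =O[atImInfty] er := by
    have hd := ModularForm.exp_isBigO_discriminant
    have h3 := h.mul (hd.inv_rev (Eventually.of_forall fun z hz =>
      absurd hz (Real.exp_pos _).ne'))
    refine (h3.congr_left fun z => ?_).congr_right fun z => ?_
    · simp [FF, div_eq_mul_inv]
    · have : rexp (-2 * π * z.im) = er z * er z := by
        rw [er, ← Real.exp_add]; ring_nf
      rw [this]
      have := (er_pos z).ne'
      field_simp
  have := (hq.trans_tendsto he).pow 2
  simp only [ne_eq, OfNat.ofNat_ne_zero, not_false_eq_true, zero_pow] at this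
  exact this

def HM : ModularForm 𝒮ℒ 0 where
  toFun := HH
  slash_action_eq' A hA := by
    obtain ⟨A, rfl⟩ := hA
    exact SlashInvariantForm.slash_action_generators_SL2Z HH_S HH_T A
  holo' := HH_md
  bdd_at_cusps' hc := by
    rw [Subgroup.IsArithmetic.isCusp_iff_isCusp_SL2Z] at hc
    rw [OnePoint.isBoundedAt_iff_forall_SL2Z hc]
    intro γ _
    rw [SlashInvariantForm.slash_action_generators_SL2Z HH_S HH_T]
    exact HH_zero.isBigO_one ℝ

lemma FF_zero : FF = 0 := by
  obtain ⟨c, hc⟩ := ModularFormClass.levelOne_weight_zero_const HM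
  have hc : HH = fun _ => c := hc
  have h0 := HH_zero
  rw [hc] at h0
  have c0 : c = 0 := tendsto_nhds_unique tendsto_const_nhds h0
  ext z
  have := congrFun hc z
  simpa [HH, c0, ModularForm.discriminant_ne_zero z] using this

lemma g_zero : g2 = 0 ∧ g3 = 0 ∧ g4 = 0 := by
  have h := FF_zero
  rw [FF, UpperHalfPlane.mul_eq_zero_iff (g2_md.mul g3_md) g4_md,
    UpperHalfPlane.mul_eq_zero_iff g2_md g3_md] at h
  have i24 : g2 = 0 → g4 = 0 := fun h => by
    have := g2_S; rw [h, SlashAction.zero_slash] at this; exact neg_eq_zero.mp this.symm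
  have i42 : g4 = 0 → g2 = 0 := fun h => by
    have := g4_S; rw [h, SlashAction.zero_slash] at this; exact neg_eq_zero.mp this.symm
  have i34 : g3 = 0 → g4 = 0 := fun h => by
    have := g3_T; rw [h, SlashAction.zero_slash] at this; exact this.symm
  have i43 : g4 = 0 → g3 = 0 := fun h => by
    have := g4_T; rw [h, SlashAction.zero_slash] at this; exact this.symm
  rcases h with (h | h) | h
  · exact ⟨h, i43 (i24 h), i24 h⟩
  · exact ⟨i42 (i34 h), h, i34 h⟩
  · exact ⟨i42 h, i43 h, h⟩

lemma Dhelp_eq (f : ℂ → ℂ) (z : ℍ) :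
    D (fun z : ℍ => f z) z = 1 / (2 * (Real.pi : ℂ) * Complex.I) * deriv f z := by
  rw [normalizedDerivOfComplex, one_div]
  congr 1
  refine EventuallyEq.deriv_eq ?_
  filter_upwards [isOpen_upperHalfPlaneSet.mem_nhds z.2] with w hw
  simp [ofComplex_apply_of_im_pos hw]

end helpers

/-- With `D = (1/2πi) d/dτ`:
`D θ₂⁴ = (1/6) θ₂⁴ (E₂ + θ₃⁴ + θ₄⁴)`, `D θ₃⁴ = (1/6) θ₃⁴ (E₂ + θ₂⁴ − θ₄⁴)`,
`D θ₄⁴ = (1/6) θ₄⁴ (E₂ − θ₂⁴ − θ₃⁴)`. -/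
theorem jacobi_theta_derivatives (τ : ℂ) (hτ : 0 < τ.im) :
    (1 / (2 * (Real.pi : ℂ) * Complex.I)) * deriv (fun t => theta2 t ^ 4) τ =
      (1 / 6) * theta2 τ ^ 4 * (E2 τ + theta3 τ ^ 4 + theta4 τ ^ 4) ∧
    (1 / (2 * (Real.pi : ℂ) * Complex.I)) * deriv (fun t => theta3 t ^ 4) τ =
      (1 / 6) * theta3 τ ^ 4 * (E2 τ + theta2 τ ^ 4 - theta4 τ ^ 4) ∧
    (1 / (2 * (Real.pi : ℂ) * Complex.I)) * deriv (fun t => theta4 t ^ 4) τ =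
      (1 / 6) * theta4 τ ^ 4 * (E2 τ - theta2 τ ^ 4 - theta3 τ ^ 4) := by
  obtain ⟨h2, h3, h4⟩ := g_zero
  have k2 := congrFun h2 ⟨τ, hτ⟩
  have k3 := congrFun h3 ⟨τ, hτ⟩
  have k4 := congrFun h4 ⟨τ, hτ⟩
  have d2 := Dhelp_eq (fun t => theta2 t ^ 4) ⟨τ, hτ⟩
  have d3 := Dhelp_eq (fun t => theta3 t ^ 4) ⟨τ, hτ⟩
  have d4 := Dhelp_eq (fun t => theta4 t ^ 4) ⟨τ, hτ⟩
  have e := E2_eq ⟨τ, hτ⟩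
  simp only [g2, g3, g4, GG, Pi.sub_apply, Pi.add_apply, Pi.neg_apply, Pi.smul_apply, Pi.mul_apply,
    smul_eq_mul, Derivative.serreDerivative_apply, e, Pi.zero_apply] at k2 k3 k4
  unfold tA tB tC at k2 k3 k4
  rw [d2] at k2
  rw [d3] at k3
  rw [d4] at k4
  refine ⟨?_, ?_, ?_⟩
  · linear_combination k2
  · linear_combination k3
  · linear_combination k4
end
end

section
/- Let z ∈ ℍ be a CM point, i.e. Az² + Bz + C = 0 for some integers A ≠ 0, B, C. Then j(z) is an algebraic number, where j = 1728 E₄³/(E₄³ − E₆²) is the modular j-invariant. -/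
open Complex

noncomputable section

/-- The modular j-invariant `j = 1728 E₄³/(E₄³ − E₆²)`. -/
def jinv (τ : ℂ) : ℂ := 1728 * E4 τ ^ 3 / (E4 τ ^ 3 - E6 τ ^ 2)

open UpperHalfPlane ModularForm ModularFormClass SlashInvariantForm EisensteinSeries Matrix.SpecialLinearGroup
open scoped MatrixGroups Manifold Pointwise

lemma sturm_aux {Γ : Subgroup (GL (Fin 2) ℝ)} [Γ.IsArithmetic] {k : ℤ}
    (hΓ : (1 : ℝ) ∈ Γ.strictPeriods) (F : ModularForm Γ k)
    (h : ∀ n ≤ (k * (Nat.card (𝒮ℒ ⧸ Γ.subgroupOf 𝒮ℒ) : ℕ)).toNat / 12,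
      (qExpansion 1 F).coeff n = 0) : F = 0 := by
  classical
  suffices hN : ModularForm.norm 𝒮ℒ F = 0 by
    have := (ModularForm.norm_eq_zero_iff (ℋ := 𝒮ℒ) F).1 hN
    exact DFunLike.coe_injective this
  apply ModularForm.sturm_bound_levelOne
  let := Fintype.ofFinite (𝒮ℒ ⧸ Γ.subgroupOf 𝒮ℒ)
  set q1 : 𝒮ℒ ⧸ Γ.subgroupOf 𝒮ℒ := ⟦1⟧ with hq1
  have hq1F : quotientFunc F q1 = F := by
    rw [hq1, quotientFunc_mk]; simp
  set R : ℍ → ℂ := ∏ q ∈ Finset.univ.erase q1, quotientFunc F q with hR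
  have hprod : (⇑(ModularForm.norm 𝒮ℒ F) : ℍ → ℂ) = F * R := by
    rw [ModularForm.coe_norm, hR, ← hq1F]
    exact (Finset.mul_prod_erase _ _ (Finset.mem_univ q1)).symm
  have hbdd : IsBoundedAtImInfty R := by
    rw [hR, IsBoundedAtImInfty, Filter.BoundedAtFilter]
    rw [show (1 : ℍ → ℝ) = (fun x ↦ ∏ i ∈ Finset.univ.erase q1, 1) by ext; simp, Finset.prod_fn]
    refine .finsetProd (Quotient.forall.mpr fun ⟨r, hr⟩ _ ↦ ?_)
    have h1 : IsCusp OnePoint.infty (𝒮ℒ) :=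
      Subgroup.isCusp_of_mem_strictPeriods (h := 1) one_pos one_mem_strictPeriods_SL
    have := (ModularForm.translate F r⁻¹).bdd_at_cusps' (c := OnePoint.infty) (by
      simpa using h1.of_isFiniteRelIndex_conj hr) 1 (by simp)
    rw [SlashAction.slash_one] at this
    exact this
  have hholo : MDifferentiable 𝓘(ℂ) 𝓘(ℂ) R := by
    exact .prod (Quotient.forall.mpr fun ⟨r, hr⟩ _ ↦ (ModularForm.translate F r⁻¹).holo')
  have hper : Function.Periodic (R ∘ ofComplex) (1 : ℝ) := by
    have ht : Matrix.GeneralLinearGroup.upperRightHom (1 : ℝ) ∈ Γ := by simpa using hΓ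
    have htS : Matrix.GeneralLinearGroup.upperRightHom (1 : ℝ) ∈ 𝒮ℒ := by
      simpa only [Subgroup.mem_strictPeriods_iff] using one_mem_strictPeriods_SL
    set t := Matrix.GeneralLinearGroup.upperRightHom (1 : ℝ) with htdef
    have hslash (f : ℍ → ℂ) (τ : ℍ) : (f ∣[k] t) τ = f ((1 : ℝ) +ᵥ τ) := by
      rw [ModularForm.slash_def]
      have e1 : t • τ = (1 : ℝ) +ᵥ τ := by
        ext; simp [htdef, UpperHalfPlane.coe_smul_of_det_pos, num, denom, add_comm]
      beta_reduce
      rw [e1]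
      simp [htdef, σ, denom]
    have hRt (τ : ℍ) : R ((1 : ℝ) +ᵥ τ) = R τ := by
      simp only [hR, Finset.prod_apply]
      simp_rw [← hslash, quotientFunc_smul F htS]
      have hfix : (⟨t, htS⟩ : 𝒮ℒ)⁻¹ • q1 = q1 := by
        rw [inv_smul_eq_iff, hq1]
        refine Quotient.sound ?_
        rw [← Quotient.eq_iff_equiv, Quotient.eq, QuotientGroup.leftRel_apply]
        simpa [Subgroup.mem_subgroupOf] using ht
      refine Finset.prod_equiv (MulAction.toPerm (⟨t, htS⟩ : 𝒮ℒ)⁻¹) ?_ ?_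
      · intro i
        simp only [Finset.mem_erase, Finset.mem_univ, and_true, MulAction.toPerm_apply]
        rw [not_iff_not]
        constructor
        · rintro rfl; exact hfix
        · intro h; rw [← hfix] at h; exact smul_left_cancel _ h
      · intro i _; rfl
    intro w
    by_cases! hw : 0 < w.im
    · have : 0 < (w + (1 : ℝ)).im := by simp [hw]
      simp only [Function.comp_apply, ofComplex_apply_of_im_pos this, ofComplex_apply_of_im_pos hw]
      rw [← hRt ⟨w, hw⟩]
      congr 1
      ext
      simp [add_comm]
    · have : (w + (1 : ℝ)).im ≤ 0 := by simpa using hw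
      simp only [Function.comp_apply, ofComplex_apply_of_im_nonpos this,
        ofComplex_apply_of_im_nonpos hw]
  have ha : AnalyticAt ℂ (cuspFunction 1 R) 0 :=
    analyticAt_cuspFunction_zero one_pos hper hholo hbdd
  rw [hprod, UpperHalfPlane.qExpansion_mul (ModularFormClass.analyticAt_cuspFunction_zero F one_pos hΓ) ha,
    PowerSeries.order_mul]
  refine lt_of_lt_of_le ?_ le_self_add
  refine lt_of_lt_of_le (b := (((k * (Nat.card (𝒮ℒ ⧸ Γ.subgroupOf 𝒮ℒ) : ℕ)).toNat / 12 + 1 : ℕ) : ℕ∞)) ?_ ?_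
  · exact_mod_cast Nat.lt_succ_self _
  · apply PowerSeries.nat_le_order
    intro i hi
    exact h i (by omega)

/-- the rational matrix `(e r; 0 1)` -/
noncomputable def gQ (e : ℕ) (he : 0 < e) (r : ℚ) : GL (Fin 2) ℚ :=
  Matrix.GeneralLinearGroup.mkOfDetNeZero !![(e : ℚ), r; 0, 1] (by
    simp [Matrix.det_fin_two]; omega)

noncomputable def gR (e : ℕ) (he : 0 < e) (r : ℚ) : GL (Fin 2) ℝ := (gQ e he r).map (Rat.castHom ℝ)

noncomputable def Gam (e : ℕ) (he : 0 < e) (r : ℚ) : Subgroup (GL (Fin 2) ℝ) :=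
  ConjAct.toConjAct (gR e he r)⁻¹ • 𝒮ℒ

instance (e : ℕ) (he : 0 < e) (r : ℚ) : (Gam e he r).IsArithmetic := by
  have := Subgroup.IsArithmetic.conj 𝒮ℒ (gQ e he r)⁻¹
  rw [Gam, gR]
  convert! this using 1

instance (e : ℕ) (he : 0 < e) (r : ℚ) : (Gam e he r).HasDetOne := by
  unfold Gam; infer_instance

lemma gR_coe (e : ℕ) (he : 0 < e) (r : ℚ) :
    (gR e he r : Matrix (Fin 2) (Fin 2) ℝ) = !![(e : ℝ), (r : ℝ); 0, 1] := by
  ext i j; fin_cases i <;> fin_cases j <;> simp [gR, gQ, Matrix.GeneralLinearGroup.mkOfDetNeZero]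

lemma gR_det (e : ℕ) (he : 0 < e) (r : ℚ) :
    (Matrix.GeneralLinearGroup.det (gR e he r)).val = e := by
  rw [Matrix.GeneralLinearGroup.val_det_apply, gR_coe]; simp [Matrix.det_fin_two]

lemma gR_smul (e : ℕ) (he : 0 < e) (r : ℚ) (τ : ℍ) :
    ((gR e he r • τ : ℍ) : ℂ) = e * τ + r := by
  have hd : 0 < (Matrix.GeneralLinearGroup.det (gR e he r)).val := by
    rw [gR_det]; exact_mod_cast he
  rw [UpperHalfPlane.coe_smul_of_det_pos hd]
  simp [num, denom, gR_coe]

lemma Gam_periods (e : ℕ) (he : 0 < e) (r : ℚ) : (1 : ℝ) ∈ (Gam e he r).strictPeriods := by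
  rw [Subgroup.mem_strictPeriods_iff, Gam, Subgroup.mem_pointwise_smul_iff_inv_smul_mem]
  have : (ConjAct.toConjAct (gR e he r)⁻¹)⁻¹ • Matrix.GeneralLinearGroup.upperRightHom (1 : ℝ)
      = Matrix.GeneralLinearGroup.upperRightHom (e : ℝ) := by
    rw [ConjAct.smul_def]
    simp only [ConjAct.ofConjAct_inv, ConjAct.ofConjAct_toConjAct, inv_inv]
    rw [mul_inv_eq_iff_eq_mul]
    ext i j
    fin_cases i <;> fin_cases j <;>
      simp [gR_coe, Matrix.mul_apply, Matrix.GeneralLinearGroup.upperRightHom, add_comm]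
  rw [this, ← Subgroup.mem_strictPeriods_iff, Subgroup.strictPeriods_SL2Z]
  exact ⟨e, by simp⟩

lemma exists_form {k : ℤ} (f : ModularForm 𝒮ℒ k) (e : ℕ) (he : 0 < e) (r : ℚ) :
    ∃ F : ModularForm (Gam e he r) k, (∀ τ, F τ = f (gR e he r • τ)) ∧
      ∀ n, (qExpansion 1 F).coeff n = if e ∣ n then
        (qExpansion 1 f).coeff (n / e) * Complex.exp (2 * Real.pi * Complex.I * r) ^ (n / e) else 0 := by
  let F : ModularForm (Gam e he r) k := ((e : ℂ) ^ (k - 1))⁻¹ • ModularForm.translate f (gR e he r)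
  have hF (τ : ℍ) : F τ = f (gR e he r • τ) := by
    change ((e : ℂ) ^ (k - 1))⁻¹ * ((f : ℍ → ℂ) ∣[k] (gR e he r)) τ = _
    rw [ModularForm.slash_def]
    beta_reduce
    have h1 : denom (gR e he r) τ = 1 := by simp [denom, gR_coe]
    have h2 : (e : ℂ) ^ (k - 1) ≠ 0 := zpow_ne_zero _ (by exact_mod_cast he.ne')
    have h3 : (0 : ℝ) < e := by exact_mod_cast he
    rw [h1, σ, gR_det]
    simp [h3]
    field_simp
  refine ⟨F, hF, fun n ↦ ?_⟩
  refine (ModularFormClass.qExpansion_coeff_unique one_pos (Gam_periods e he r) (c := fun n ↦ if e ∣ n then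
        (qExpansion 1 f).coeff (n / e) * Complex.exp (2 * Real.pi * Complex.I * r) ^ (n / e) else 0) ?_ n).symm
  intro τ
  have : Fact (IsCusp OnePoint.infty (𝒮ℒ)) := ⟨Subgroup.isCusp_of_mem_strictPeriods (h := 1) one_pos one_mem_strictPeriods_SL⟩
  have hs := ModularForm.hasSum_qExpansion f one_pos one_mem_strictPeriods_SL (gR e he r • τ)
  rw [← hF] at hs
  have hinj : Function.Injective (fun n : ℕ ↦ e * n) := fun a b h ↦ Nat.eq_of_mul_eq_mul_left he h
  rw [← hinj.hasSum_iff]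
  · convert hs using 2 with n
    simp only [Function.comp_apply, dvd_mul_right, if_true, Nat.mul_div_cancel_left _ he, smul_eq_mul]
    rw [mul_assoc, pow_mul, ← mul_pow]
    congr 2
    simp only [Function.Periodic.qParam, gR_smul]
    rw [← Complex.exp_nat_mul, ← Complex.exp_add]
    congr 1
    push_cast
    ring
  · intro x hx
    have : ¬ e ∣ x := fun ⟨y, hy⟩ ↦ hx ⟨y, hy.symm⟩
    simp [this]

/-- algebraic numbers -/
noncomputable abbrev KK : IntermediateField ℚ ℂ := algebraicClosure ℚ ℂ

noncomputable def KS : Subring (PowerSeries ℂ) := (PowerSeries.map (algebraMap KK ℂ)).range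

lemma mem_KS_iff (p : PowerSeries ℂ) : p ∈ KS ↔ ∀ n, p.coeff n ∈ KK := by
  constructor
  · rintro ⟨q, rfl⟩ n
    rw [PowerSeries.coeff_map]
    exact (q.coeff n).2
  · intro h
    refine ⟨PowerSeries.mk fun n ↦ ⟨p.coeff n, h n⟩, ?_⟩
    ext n
    rw [PowerSeries.coeff_map, PowerSeries.coeff_mk]
    rfl

lemma E_mem_KS {k : ℕ} (hk : 3 ≤ k) (hk2 : Even k) : qExpansion 1 (ModularForm.E hk) ∈ KS := by
  rw [mem_KS_iff]
  intro n
  rw [E_qExpansion_coeff hk hk2]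
  split_ifs
  · exact one_mem _
  · refine mul_mem (neg_mem (div_mem (mul_mem (ofNat_mem _ 2) (natCast_mem _ _)) ?_)) (natCast_mem _ _)
    exact KK.algebraMap_mem (bernoulli k)

noncomputable def A0 : ModularForm 𝒮ℒ 12 := ModularForm.mcast (by decide) (E₄.pow 3)
noncomputable def D0 : ModularForm 𝒮ℒ 12 :=
  ModularForm.mcast (by decide) (E₄.pow 3) - ModularForm.mcast (by decide) (E₆.pow 2)

lemma A0_apply (z : ℍ) : A0 z = E₄ z ^ 3 := by
  simp only [A0, coe_mcast, ModularForm.coe_pow, Pi.pow_apply]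

lemma D0_apply (z : ℍ) : D0 z = E₄ z ^ 3 - E₆ z ^ 2 := by
  simp only [D0, coe_mcast, ModularForm.coe_pow, sub_apply, Pi.pow_apply]

lemma D0_ne_zero (z : ℍ) : D0 z ≠ 0 := by
  have h := ModularForm.discriminant_eq_E₄_cube_sub_E₆_sq z
  have h2 := ModularForm.discriminant_ne_zero z
  rw [D0_apply]
  intro h3
  rw [h3] at h
  exact h2 (by simpa using h)

lemma A0_q : qExpansion 1 A0 = qExpansion 1 E₄ ^ 3 := by
  simp only [A0, coe_mcast, ModularForm.qExpansion_pow one_pos one_mem_strictPeriods_SL]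

lemma D0_q : qExpansion 1 D0 = qExpansion 1 E₄ ^ 3 - qExpansion 1 E₆ ^ 2 := by
  simp only [D0, FunLike.coe_sub, coe_mcast,
    ModularForm.qExpansion_sub one_pos one_mem_strictPeriods_SL,
    ModularForm.qExpansion_pow one_pos one_mem_strictPeriods_SL]

lemma A0_mem : qExpansion 1 A0 ∈ KS := by
  rw [A0_q]; exact pow_mem (E_mem_KS _ (by decide)) _

lemma D0_mem : qExpansion 1 D0 ∈ KS := by
  rw [D0_q]; exact sub_mem (pow_mem (E_mem_KS _ (by decide)) _) (pow_mem (E_mem_KS _ (by decide)) _)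

lemma A0_zero : (qExpansion 1 A0).coeff 0 = 1 := by
  rw [A0_q]
  simp [pow_succ, PowerSeries.coeff_mul, -PowerSeries.coeff_zero_eq_constantCoeff,
    E_qExpansion_coeff_zero _ ⟨2, rfl⟩]

lemma D0_zero : (qExpansion 1 D0).coeff 0 = 0 := by
  rw [D0_q]
  simp [pow_succ, PowerSeries.coeff_mul, -PowerSeries.coeff_zero_eq_constantCoeff,
    E_qExpansion_coeff_zero _ ⟨2, rfl⟩, E_qExpansion_coeff_zero _ ⟨3, rfl⟩]

lemma D0_one : (qExpansion 1 D0).coeff 1 = 1728 := by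
  rw [D0_q, pow_succ, pow_two, pow_two]
  norm_num [PowerSeries.coeff_mul, Finset.Nat.antidiagonal_succ, E₄_qExpansion_coeff_one,
    E₆_qExpansion_coeff_one, E_qExpansion_coeff_zero _ ⟨2, rfl⟩,
    E_qExpansion_coeff_zero _ ⟨3, rfl⟩]

/-- the `j` function up to the factor 1728 -/
noncomputable def Jf (z : ℍ) : ℂ := A0 z / D0 z

lemma Jf_SL (γ : SL(2, ℤ)) (z : ℍ) : Jf (γ • z) = Jf z := by
  have hm : (mapGL ℝ γ) ∈ 𝒮ℒ := ⟨γ, rfl⟩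
  have h1 := SlashInvariantForm.slash_action_eqn'' A0 hm z
  have h2 := SlashInvariantForm.slash_action_eqn'' D0 hm z
  have h3 : denom (mapGL ℝ γ) z ^ (12 : ℤ) ≠ 0 := zpow_ne_zero _ (denom_ne_zero _ _)
  change A0 (mapGL ℝ γ • z) / D0 (mapGL ℝ γ • z) = _
  rw [h1, h2, mul_div_mul_left _ _ h3, Jf]

lemma E4_eq (z : ℍ) : E4 z = E₄ z := by
  have h := EisensteinSeries.q_expansion_bernoulli (k := 4) (by norm_num) (by decide) z
  rw [h, E4]
  rw [tsum_pnat_eq_tsum_succ (f := fun n : ℕ ↦ (ArithmeticFunction.sigma (4 - 1) n : ℂ) * Complex.exp (2 * Real.pi * Complex.I * z) ^ (n : ℤ))]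
  have hb : bernoulli 4 = -1/30 := by decide +kernel
  rw [hb, sub_eq_add_neg, ← neg_mul]
  congr 2
  · norm_num
  · congr 1
    ext n
    congr 1
    rw [qp, zpow_natCast, ← Complex.exp_nat_mul]
    push_cast; ring_nf

lemma E6_eq (z : ℍ) : E6 z = E₆ z := by
  have h := EisensteinSeries.q_expansion_bernoulli (k := 6) (by norm_num) (by decide) z
  rw [h, E6]
  rw [tsum_pnat_eq_tsum_succ (f := fun n : ℕ ↦ (ArithmeticFunction.sigma (6 - 1) n : ℂ) * Complex.exp (2 * Real.pi * Complex.I * z) ^ (n : ℤ))]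
  have hb : bernoulli 6 = 1/42 := by decide +kernel
  rw [hb]
  congr 2
  · norm_num
  · congr 1
    ext n
    congr 1
    rw [qp, zpow_natCast, ← Complex.exp_nat_mul]
    push_cast; ring_nf

lemma jinv_eq (z : ℍ) : jinv z = 1728 * Jf z := by
  rw [jinv, Jf, A0_apply, D0_apply, E4_eq, E6_eq, mul_div_assoc]

lemma div_pow_aux (x y : ℂ) (hy : y ≠ 0) (i m : ℕ) (h : i ≤ m) :
    (x / y) ^ i * y ^ m = x ^ i * y ^ (m - i) := by
  obtain ⟨l, rfl⟩ := Nat.exists_eq_add_of_le h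
  rw [pow_add, ← mul_assoc, ← mul_pow, div_mul_cancel₀ _ hy, Nat.add_sub_cancel_left]

lemma qExp_sum {Γ : Subgroup (GL (Fin 2) ℝ)} {k : ℤ} [Γ.HasDetOne]
    (hΓ : (1 : ℝ) ∈ Γ.strictPeriods) {ι : Type*} (s : Finset ι) (c : ι → ℂ) (F : ι → ModularForm Γ k) (n : ℕ) :
    (qExpansion 1 (∑ i ∈ s, c i • F i : ModularForm Γ k)).coeff n
      = ∑ i ∈ s, c i * (qExpansion 1 (F i)).coeff n := by
  have h1 : qExpansion 1 (∑ i ∈ s, c i • F i : ModularForm Γ k)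
      = qExpansionAddHom one_pos hΓ k (∑ i ∈ s, c i • F i) := rfl
  rw [h1, map_sum, map_sum]
  refine Finset.sum_congr rfl fun i _ ↦ ?_
  change (qExpansion 1 (c i • F i : ModularForm Γ k)).coeff n = _
  rw [FunLike.coe_smul, ModularForm.qExpansion_smul one_pos hΓ]
  simp

lemma exists_rel {Γ : Subgroup (GL (Fin 2) ℝ)} [Γ.IsArithmetic] {k : ℤ} [Γ.HasDetOne]
    (hΓ : (1 : ℝ) ∈ Γ.strictPeriods) {ι : Type} [Fintype ι] (F : ι → ModularForm Γ k)
    (hF : ∀ i, qExpansion 1 (F i) ∈ KS)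
    (hcard : (k * (Nat.card (𝒮ℒ ⧸ Γ.subgroupOf 𝒮ℒ) : ℕ)).toNat / 12 + 1 < Fintype.card ι) :
    ∃ c : ι → KK, c ≠ 0 ∧ ∑ i, (c i : ℂ) • F i = 0 := by
  classical
  set N := (k * (Nat.card (𝒮ℒ ⧸ Γ.subgroupOf 𝒮ℒ) : ℕ)).toNat / 12
  let M : Matrix (Fin (N + 1)) ι KK := fun n i ↦ ⟨(qExpansion 1 (F i)).coeff n, (mem_KS_iff _).1 (hF i) n⟩
  have hker : LinearMap.ker (Matrix.mulVecLin M) ≠ ⊥ :=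
    LinearMap.ker_ne_bot_of_finrank_lt (by simpa using hcard)
  obtain ⟨c, hc, hc0⟩ := Submodule.exists_mem_ne_zero_of_ne_bot hker
  refine ⟨c, hc0, ?_⟩
  apply sturm_aux hΓ
  intro n hn
  rw [qExp_sum hΓ]
  have h2 := congrFun (LinearMap.mem_ker.1 hc) ⟨n, Nat.lt_succ_of_le hn⟩
  have h3 := congrArg (algebraMap KK ℂ) h2
  simp only [Matrix.mulVecLin_apply, Matrix.mulVec, dotProduct, map_sum, map_mul, Pi.zero_apply, map_zero] at h3
  rw [← h3]
  refine Finset.sum_congr rfl fun i _ ↦ ?_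
  rw [mul_comm]
  rfl

lemma exists_rel2 {Γ : Subgroup (GL (Fin 2) ℝ)} [Γ.IsArithmetic] [Γ.HasDetOne]
    (hΓ : (1 : ℝ) ∈ Γ.strictPeriods) (A1 D1 A2 D2 : ModularForm Γ 12)
    (hA1 : qExpansion 1 A1 ∈ KS) (hD1 : qExpansion 1 D1 ∈ KS)
    (hA2 : qExpansion 1 A2 ∈ KS) (hD2 : qExpansion 1 D2 ∈ KS)
    (hd1 : ∀ τ, D1 τ ≠ 0) (hd2 : ∀ τ, D2 τ ≠ 0) :
    ∃ (m : ℕ) (c : Fin m × Fin m → KK), c ≠ 0 ∧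
      ∀ τ, ∑ p, (c p : ℂ) * ((A1 τ / D1 τ) ^ (p.1 : ℕ) * (A2 τ / D2 τ) ^ (p.2 : ℕ)) = 0 := by
  set μ := Nat.card (𝒮ℒ ⧸ Γ.subgroupOf 𝒮ℒ) with hμ
  let m := 2 * μ + 1
  let F : Fin (m + 1) × Fin (m + 1) → ModularForm Γ (24 * m) := fun p ↦
    ModularForm.mcast (by
      have h1 := p.1.is_le
      have h2 := p.2.is_le
      push_cast [Nat.cast_sub h1, Nat.cast_sub h2]
      ring)
      (((A1.pow p.1).mul (D1.pow (m - p.1))).mul ((A2.pow p.2).mul (D2.pow (m - p.2))))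
  obtain ⟨c, hc, h⟩ := exists_rel hΓ F (by
    intro p
    simp only [F, coe_mcast, ModularForm.qExpansion_mul one_pos hΓ, ModularForm.qExpansion_pow one_pos hΓ]
    exact mul_mem (mul_mem (pow_mem hA1 _) (pow_mem hD1 _)) (mul_mem (pow_mem hA2 _) (pow_mem hD2 _))) (by
    have : ((24 * m : ℤ) * (μ : ℕ)).toNat = 24 * m * μ := by
      rw [← Int.toNat_natCast (24 * m * μ)]; push_cast; rfl
    rw [this]
    have h2 : 24 * m * μ / 12 = 2 * m * μ := by
      rw [show 24 * m * μ = 12 * (2 * m * μ) by ring, Nat.mul_div_cancel_left _ (by norm_num)]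
    rw [h2]
    simp only [Fintype.card_prod, Fintype.card_fin, m]
    nlinarith)
  refine ⟨m + 1, c, hc, fun τ ↦ ?_⟩
  have h1 := congrArg (fun f : ModularForm Γ (24 * m) ↦ f τ) h
  have h0 : ∀ s : Finset (Fin (m + 1) × Fin (m + 1)),
      (∑ i ∈ s, (c i : ℂ) • F i : ModularForm Γ (24 * m)) τ = ∑ i ∈ s, (c i : ℂ) * F i τ := by
    intro s
    classical
    induction s using Finset.induction_on with
    | empty => simp
    | insert a s ha ih => rw [Finset.sum_insert ha, Finset.sum_insert ha, ← ih]; rfl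
  simp only [h0] at h1
  have h2 : (∑ p, (c p : ℂ) * ((A1 τ / D1 τ) ^ (p.1 : ℕ) * (A2 τ / D2 τ) ^ (p.2 : ℕ)))
      * (D1 τ ^ m * D2 τ ^ m) = ∑ p, (c p : ℂ) * F p τ := by
    rw [Finset.sum_mul]
    refine Finset.sum_congr rfl fun p _ ↦ ?_
    have hFp : F p τ = (A1 τ ^ (p.1 : ℕ) * D1 τ ^ (m - p.1)) * (A2 τ ^ (p.2 : ℕ) * D2 τ ^ (m - p.2)) := by
      simp only [F, coe_mcast, ModularForm.coe_mul, ModularForm.coe_pow, Pi.mul_apply, Pi.pow_apply]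
    have f1 : (A1 τ / D1 τ) ^ (p.1 : ℕ) * D1 τ ^ m = A1 τ ^ (p.1 : ℕ) * D1 τ ^ (m - p.1) := by
      exact div_pow_aux _ _ (hd1 τ) _ _ p.1.is_le
    have f2 : (A2 τ / D2 τ) ^ (p.2 : ℕ) * D2 τ ^ m = A2 τ ^ (p.2 : ℕ) * D2 τ ^ (m - p.2) := by
      exact div_pow_aux _ _ (hd2 τ) _ _ p.2.is_le
    rw [hFp, ← f1, ← f2]; ring
  have h3 : D1 τ ^ m * D2 τ ^ m ≠ 0 := mul_ne_zero (pow_ne_zero _ (hd1 τ)) (pow_ne_zero _ (hd2 τ))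
  refine (mul_eq_zero.1 (h2.trans ?_)).resolve_right h3
  simpa using h1

/-- evaluation of a two-variable polynomial -/
def ev2 (x y : ℂ) : Polynomial (Polynomial KK) →+* ℂ :=
  Polynomial.eval₂RingHom (Polynomial.eval₂RingHom (algebraMap KK ℂ) x) y

lemma ev2_cont {X : Type*} [TopologicalSpace X] (f g : X → ℂ) (hf : Continuous f) (hg : Continuous g)
    (P : Polynomial (Polynomial KK)) : Continuous fun τ ↦ ev2 (f τ) (g τ) P := by
  simp only [ev2, Polynomial.coe_eval₂RingHom, Polynomial.eval₂_eq_sum_range]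
  fun_prop

lemma poly_step (f g : ℍ → ℂ) (hf : MDiff f) (hg : MDiff g) (hne : f ≠ g)
    (P : Polynomial (Polynomial KK)) (hP : P ≠ 0) (h : ∀ τ, ev2 (f τ) (g τ) P = 0)
    (τ₀ : ℍ) (heq : f τ₀ = g τ₀) : IsAlgebraic ℚ (f τ₀) := by
  obtain ⟨Q, hQ, hQ2⟩ := Polynomial.exists_eq_pow_rootMultiplicity_mul_and_not_dvd P hP Polynomial.X
  have hev : ∀ᶠ τ in nhdsWithin τ₀ {τ₀}ᶜ, ev2 (f τ) (g τ) Q = 0 := by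
    have h1 : ¬ ∃ᶠ τ in nhdsWithin τ₀ {τ₀}ᶜ, (g - f) τ = 0 := by
      intro h2
      have := UpperHalfPlane.eq_zero_of_frequently (hg.sub hf) h2
      exact hne (sub_eq_zero.1 this).symm
    rw [Filter.not_frequently] at h1
    filter_upwards [h1] with τ hτ
    have h3 := h τ
    rw [hQ, map_mul, map_pow] at h3
    have h4 : ev2 (f τ) (g τ) (Polynomial.X - Polynomial.C Polynomial.X) = (g - f) τ := by
      simp [ev2]
    rw [h4] at h3
    exact (mul_eq_zero.1 h3).resolve_left (pow_ne_zero _ hτ)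
  have hzero : ev2 (f τ₀) (g τ₀) Q = 0 := by
    have hc := (ev2_cont f g hf.continuous hg.continuous Q).tendsto τ₀
    have hne : (nhdsWithin τ₀ {τ₀}ᶜ).NeBot := inferInstance
    have hc2 := hc.mono_left (nhdsWithin_le_nhds (s := {τ₀}ᶜ))
    refine tendsto_nhds_unique hc2 ?_
    exact tendsto_const_nhds.congr' (hev.mono fun τ hτ ↦ hτ.symm)
  have hR : Q.eval Polynomial.X ≠ 0 := by
    intro h0
    exact hQ2 (Polynomial.dvd_iff_isRoot.2 h0)
  rw [← heq] at hzero
  have hcomp : ev2 (f τ₀) (f τ₀) Q = (Q.eval Polynomial.X).eval₂ (algebraMap KK ℂ) (f τ₀) := by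
    have := Polynomial.hom_eval₂ Q (RingHom.id _) (Polynomial.eval₂RingHom (algebraMap KK ℂ) (f τ₀)) Polynomial.X
    rw [RingHom.comp_id, Polynomial.coe_eval₂RingHom, Polynomial.eval₂_X] at this
    exact this.symm
  have halg : IsAlgebraic KK (f τ₀) := ⟨_, hR, by rw [Polynomial.aeval_def, ← hcomp, hzero]⟩
  have : Algebra.IsAlgebraic ℚ KK := algebraicClosure.isAlgebraic ℚ ℂ
  exact halg.restrictScalars ℚ

lemma rel_step (f g : ℍ → ℂ) (hf : MDiff f) (hg : MDiff g) (hne : f ≠ g)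
    (m : ℕ) (c : Fin m × Fin m → KK) (hc : c ≠ 0)
    (h : ∀ τ, ∑ p, (c p : ℂ) * (f τ ^ (p.1 : ℕ) * g τ ^ (p.2 : ℕ)) = 0)
    (τ₀ : ℍ) (heq : f τ₀ = g τ₀) : IsAlgebraic ℚ (f τ₀) := by
  let P : Polynomial (Polynomial KK) :=
    ∑ p : Fin m × Fin m, Polynomial.monomial (p.2 : ℕ) (Polynomial.monomial (p.1 : ℕ) (c p))
  refine poly_step f g hf hg hne P ?_ ?_ τ₀ heq
  · intro h0
    apply hc
    ext1 q
    have h1 := congrArg (fun P ↦ (P.coeff (q.2 : ℕ)).coeff (q.1 : ℕ)) h0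
    simp only [P, Polynomial.finsetSum_coeff, Polynomial.coeff_monomial, Polynomial.coeff_zero] at h1
    rw [Finset.sum_eq_single q] at h1
    · simpa using h1
    · intro b _ hb
      by_cases h2 : (b.2 : ℕ) = q.2
      · have h3 : (b.1 : ℕ) ≠ q.1 := fun h3 ↦ hb (Prod.ext (Fin.ext h3) (Fin.ext h2))
        simp [h2, Polynomial.coeff_monomial, h3]
      · simp [h2]
    · simp
  · intro τ
    rw [← h τ]
    simp only [P, map_sum, ev2, Polynomial.coe_eval₂RingHom, Polynomial.eval₂_monomial]
    refine Finset.sum_congr rfl fun p _ ↦ ?_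
    rw [mul_assoc]
    rfl

lemma zeta_mem (r : ℚ) : Complex.exp (2 * Real.pi * Complex.I * r) ∈ KK := by
  rw [mem_algebraicClosure_iff]
  refine IsIntegral.isAlgebraic ?_
  refine IsIntegral.of_pow (n := r.den) r.den_pos ?_
  have : Complex.exp (2 * Real.pi * Complex.I * r) ^ r.den = 1 := by
    rw [← Complex.exp_nat_mul, Complex.exp_eq_one_iff]
    refine ⟨r.num, ?_⟩
    have h := Rat.mul_den_eq_num r
    have h2 : (r : ℂ) * r.den = r.num := by exact_mod_cast congrArg (fun x : ℚ ↦ (x : ℂ)) h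
    rw [← h2]; ring
  rw [this]
  exact isIntegral_one

lemma exists_pair (e : ℕ) (he : 0 < e) (r : ℚ) :
    ∃ A D : ModularForm (Gam e he r) 12, (∀ τ, A τ = A0 (gR e he r • τ)) ∧ (∀ τ, D τ = D0 (gR e he r • τ)) ∧
      qExpansion 1 A ∈ KS ∧ qExpansion 1 D ∈ KS ∧ (qExpansion 1 A).order = 0 ∧
      (qExpansion 1 D).order = e := by
  obtain ⟨A, hA, hA2⟩ := exists_form A0 e he r
  obtain ⟨D, hD, hD2⟩ := exists_form D0 e he r
  refine ⟨A, D, hA, hD, ?_, ?_, ?_, ?_⟩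
  · rw [mem_KS_iff]; intro n; rw [hA2]
    split_ifs
    · exact mul_mem ((mem_KS_iff _).1 A0_mem _) (pow_mem (zeta_mem r) _)
    · exact zero_mem _
  · rw [mem_KS_iff]; intro n; rw [hD2]
    split_ifs
    · exact mul_mem ((mem_KS_iff _).1 D0_mem _) (pow_mem (zeta_mem r) _)
    · exact zero_mem _
  · have := (PowerSeries.order_eq_nat (φ := qExpansion 1 A) (n := 0)).2 ⟨by
      rw [hA2, if_pos (dvd_zero e), Nat.zero_div, A0_zero]; simp, by simp⟩
    exact_mod_cast this
  · refine PowerSeries.order_eq_nat.2 ⟨?_, ?_⟩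
    · rw [hD2, if_pos dvd_rfl, Nat.div_self he, D0_one]
      simp [Complex.exp_ne_zero]
    · intro i hi
      rw [hD2]
      split_ifs with h
      · rw [Nat.eq_zero_of_dvd_of_lt h hi, Nat.zero_div, D0_zero, zero_mul]
      · rfl

/-- restriction of level -/
def resF {Γ Γ' : Subgroup (GL (Fin 2) ℝ)} {k : ℤ} (h : Γ' ≤ Γ) (f : ModularForm Γ k) : ModularForm Γ' k where
  toFun := f
  holo' := f.holo'
  bdd_at_cusps' hc := f.bdd_at_cusps' (hc.mono h)
  slash_action_eq' γ hγ := f.slash_action_eq' γ (h hγ)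

lemma main_step (d a : ℕ) (hd : 0 < d) (ha : 0 < a) (r : ℚ) (hda : a ≠ d) (τ₀ : ℍ)
    (heq : Jf (gR d hd 0 • τ₀) = Jf (gR a ha r • τ₀)) : IsAlgebraic ℚ (Jf (gR d hd 0 • τ₀)) := by
  obtain ⟨A1', D1', hA1, hD1, hA1K, hD1K, hA1o, hD1o⟩ := exists_pair d hd 0
  obtain ⟨A2', D2', hA2, hD2, hA2K, hD2K, hA2o, hD2o⟩ := exists_pair a ha r
  let Γ := Gam d hd 0 ⊓ Gam a ha r
  have hΓ : (1 : ℝ) ∈ Γ.strictPeriods := by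
    rw [Subgroup.mem_strictPeriods_iff]
    exact ⟨Subgroup.mem_strictPeriods_iff.1 (Gam_periods d hd 0), Subgroup.mem_strictPeriods_iff.1 (Gam_periods a ha r)⟩
  have : Γ.IsArithmetic := by dsimp only [Γ]; infer_instance
  have : Γ.HasDetOne := ⟨fun {g} hg ↦ Subgroup.HasDetOne.det_eq hg.1⟩
  let A1 : ModularForm Γ 12 := resF inf_le_left A1'
  let D1 : ModularForm Γ 12 := resF inf_le_left D1'
  let A2 : ModularForm Γ 12 := resF inf_le_right A2'
  let D2 : ModularForm Γ 12 := resF inf_le_right D2'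
  have hd1 (τ : ℍ) : D1 τ ≠ 0 := by
    change D1' τ ≠ 0
    rw [hD1]; exact D0_ne_zero _
  have hd2 (τ : ℍ) : D2 τ ≠ 0 := by
    change D2' τ ≠ 0
    rw [hD2]; exact D0_ne_zero _
  obtain ⟨m, c, hc, hrel⟩ := exists_rel2 hΓ A1 D1 A2 D2 hA1K hD1K hA2K hD2K hd1 hd2
  have hJ1 (τ : ℍ) : A1 τ / D1 τ = Jf (gR d hd 0 • τ) := by
    change A1' τ / D1' τ = _
    rw [hA1, hD1, Jf]
  have hJ2 (τ : ℍ) : A2 τ / D2 τ = Jf (gR a ha r • τ) := by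
    change A2' τ / D2' τ = _
    rw [hA2, hD2, Jf]
  have hmd (f g : ModularForm Γ 12) (hg : ∀ τ, g τ ≠ 0) : MDiff (fun τ ↦ f τ / g τ) := by
    have h1 := UpperHalfPlane.mdifferentiable_iff.1 f.holo'
    have h2 := UpperHalfPlane.mdifferentiable_iff.1 g.holo'
    exact UpperHalfPlane.mdifferentiable_iff.2 (h1.div h2 fun z hz ↦ hg _)
  rw [← hJ1]
  refine rel_step (fun τ ↦ A1 τ / D1 τ) (fun τ ↦ A2 τ / D2 τ) (hmd _ _ hd1) (hmd _ _ hd2) ?_ m c hc hrel τ₀ ?_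
  · intro h
    have h1 : A1.mul D2 = A2.mul D1 := by
      ext τ
      have := congrFun h τ
      rw [div_eq_div_iff (hd1 τ) (hd2 τ)] at this
      simpa only [ModularForm.coe_mul, Pi.mul_apply] using this
    have h2 : qExpansion 1 (A1.mul D2) = qExpansion 1 (A2.mul D1) := by rw [h1]
    rw [ModularForm.qExpansion_mul one_pos hΓ, ModularForm.qExpansion_mul one_pos hΓ] at h2
    have h3 := congrArg PowerSeries.order h2
    rw [PowerSeries.order_mul, PowerSeries.order_mul] at h3
    change (qExpansion 1 A1').order + (qExpansion 1 D2').order = (qExpansion 1 A2').order + (qExpansion 1 D1').order at h3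
    rw [hA1o, hA2o, hD1o, hD2o, zero_add, zero_add] at h3
    exact hda (by exact_mod_cast h3)
  · change A1 τ₀ / D1 τ₀ = A2 τ₀ / D2 τ₀
    rw [hJ1, hJ2, heq]

lemma exists_upper {N : ℤ} (hN : N ≠ 0) (M : FixedDetMatrix (Fin 2) ℤ N) :
    ∃ γ : SL(2, ℤ), (γ.1 * M.1) 1 0 = 0 ∧ 0 < (γ.1 * M.1) 0 0 := by
  induction M using (FixedDetMatrices.induction_on hN) with
  | h0 A a1 a4 _ a6 => exact ⟨1, by simpa using a1, by simpa using a4⟩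
  | hS B hb =>
    obtain ⟨γ, h1, h2⟩ := hb
    refine ⟨γ * ModularGroup.S⁻¹, ?_⟩
    rw [FixedDetMatrices.smul_coe, ← mul_assoc, ← Matrix.SpecialLinearGroup.coe_mul, inv_mul_cancel_right]
    exact ⟨h1, h2⟩
  | hT B hb =>
    obtain ⟨γ, h1, h2⟩ := hb
    refine ⟨γ * ModularGroup.T⁻¹, ?_⟩
    rw [FixedDetMatrices.smul_coe, ← mul_assoc, ← Matrix.SpecialLinearGroup.coe_mul, inv_mul_cancel_right]
    exact ⟨h1, h2⟩

lemma disc_pos (z : ℂ) (hz : 0 < z.im) (A B C : ℤ) (hA : A ≠ 0)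
    (hquad : (A : ℂ) * z ^ 2 + (B : ℂ) * z + (C : ℂ) = 0) : 0 < 4 * A * C - B ^ 2 := by
  have h1 : (2 * A * z + B) ^ 2 = (((B ^ 2 - 4 * A * C : ℤ) : ℝ) : ℂ) := by
    push_cast
    linear_combination 4 * (A : ℂ) * hquad
  have hre := congrArg Complex.re h1
  have him := congrArg Complex.im h1
  rw [Complex.ofReal_re] at hre
  rw [Complex.ofReal_im] at him
  simp [pow_two] at hre him
  have hA' : (A : ℝ) ≠ 0 := by exact_mod_cast hA
  have h2 : (2 * A * z.im : ℝ) ≠ 0 := mul_ne_zero (mul_ne_zero two_ne_zero hA') hz.ne'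
  have h3 : (2 * A * z.re + B : ℝ) = 0 := by
    have : (2 * A * z.im : ℝ) * (2 * A * z.re + B) = 0 := by linarith
    exact (mul_eq_zero.1 this).resolve_left h2
  have h4 : (0 : ℝ) < (4 * A * C - B ^ 2 : ℤ) := by
    push_cast
    have := mul_self_pos.2 h2
    rw [h3] at hre
    nlinarith
  exact_mod_cast h4

lemma Jf_CM (z : ℍ) (A B C : ℤ) (hA : A ≠ 0)
    (hquad : (A : ℂ) * (z : ℂ) ^ 2 + (B : ℂ) * z + (C : ℂ) = 0) : IsAlgebraic ℚ (Jf z) := by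
  have hD := disc_pos z z.im_pos A B C hA hquad
  set D := 4 * A * C - B ^ 2 with hDdef
  obtain ⟨t, ht⟩ : ∃ t : ℤ, D < 2 * t - B := ⟨|B| + D, by have := le_abs_self B; have := abs_nonneg B; linarith⟩
  set N := t ^ 2 - B * t + A * C with hNdef
  have h4N : 4 * N = (2 * t - B) ^ 2 + D := by rw [hNdef, hDdef]; ring
  have hN : 0 < N := by nlinarith [sq_nonneg (2 * t - B)]
  have hsq : ∀ n : ℤ, 0 < n → n * n ≠ N := by
    intro n hn h
    have h5 : (2 * n) ^ 2 = (2 * t - B) ^ 2 + D := by rw [← h4N, ← h]; ring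
    have h6 : 2 * t - B < 2 * n := by
      by_contra h7
      push Not at h7
      nlinarith
    nlinarith
  let M : FixedDetMatrix (Fin 2) ℤ N := ⟨!![t - B, -C; A, t], by rw [Matrix.det_fin_two_of, hNdef]; ring⟩
  obtain ⟨γ, h10, h00⟩ := exists_upper hN.ne' M
  have hdetγ := γ.2
  rw [Matrix.det_fin_two] at hdetγ
  obtain ⟨p, hp⟩ : ∃ p, p = γ.1 0 0 := ⟨_, rfl⟩
  obtain ⟨q, hq⟩ : ∃ q, q = γ.1 0 1 := ⟨_, rfl⟩
  obtain ⟨s, hs⟩ : ∃ s, s = γ.1 1 0 := ⟨_, rfl⟩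
  obtain ⟨u, hu⟩ : ∃ u, u = γ.1 1 1 := ⟨_, rfl⟩
  simp only [M, Matrix.mul_apply, Fin.sum_univ_two] at h10 h00
  simp only [← hp, ← hq, ← hs, ← hu] at hdetγ h10 h00
  simp at h10 h00
  obtain ⟨a, haa⟩ : ∃ a, a = p * (t - B) + q * A := ⟨_, rfl⟩
  obtain ⟨b, hbb⟩ : ∃ b, b = -p * C + q * t := ⟨_, rfl⟩
  obtain ⟨d, hdd⟩ : ∃ d, d = -s * C + u * t := ⟨_, rfl⟩
  rw [← haa] at h00
  have had : a * d = N := by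
    have : a * d = a * d - b * (s * (t - B) + u * A) := by rw [h10]; ring
    rw [this, haa, hbb, hdd, hNdef]
    linear_combination (t ^ 2 - B * t + A * C) * hdetγ
  have hd : 0 < d := by
    by_contra h
    push Not at h
    nlinarith
  have hne : a ≠ d := by
    rintro rfl
    exact hsq _ h00 had
  -- the action
  have hden : (s : ℂ) * z + u ≠ 0 := by
    have := UpperHalfPlane.denom_ne_zero (mapGL ℝ γ) z
    simpa [denom, hs, hu] using this
  have hγz : ((γ • z : ℍ) : ℂ) = (p * z + q) / (s * z + u) := by
    rw [UpperHalfPlane.specialLinearGroup_apply]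
    simp [hp, hq, hs, hu]
  have hact : (a : ℂ) * z + b = d * ((γ • z : ℍ) : ℂ) := by
    rw [hγz, mul_div_assoc', eq_div_iff hden]
    have h10' : (s : ℂ) * (t - B) + u * A = 0 := by exact_mod_cast h10
    have e1 : (a : ℂ) * z + b = (A * z + t) * (p * z + q) := by
      rw [haa, hbb]; push_cast
      linear_combination -(p : ℂ) * hquad
    have e2 : (d : ℂ) = (A * z + t) * (s * z + u) := by
      rw [hdd]; push_cast
      linear_combination -(s : ℂ) * hquad - (z : ℂ) * h10'
    rw [e1, e2]; ring
  lift a to ℕ using h00.le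
  lift d to ℕ using hd.le
  have ha' : 0 < a := by exact_mod_cast h00
  have hd' : 0 < d := by exact_mod_cast hd
  have hdR : (0 : ℝ) < d := by exact_mod_cast hd'
  have hdC : (d : ℂ) ≠ 0 := by exact_mod_cast hd'.ne'
  let σ₀ : ℍ := ⟨(z : ℂ) / d, by
    have : ((z : ℂ) / d).im = z.im / d := by
      rw [show ((d : ℂ)) = ((d : ℝ) : ℂ) by simp, Complex.div_ofReal_im]; rfl
    rw [this]; exact div_pos z.im_pos hdR⟩
  have hσ : (σ₀ : ℂ) = z / d := rfl
  have g1 : gR d hd' 0 • σ₀ = z := by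
    apply UpperHalfPlane.ext
    rw [gR_smul, hσ]
    field_simp
    simp
  have g2 : gR a ha' (b / d) • σ₀ = γ • z := by
    apply UpperHalfPlane.ext
    rw [gR_smul, hσ]
    push_cast at hact ⊢
    field_simp
    exact hact
  have := main_step d a hd' ha' (b / d) (by exact_mod_cast hne) σ₀ (by rw [g1, g2, Jf_SL])
  rwa [g1] at this

/-- If `z ∈ ℍ` is a CM point (i.e. `Az² + Bz + C = 0` with integers `A ≠ 0`, `B`, `C`),
then `j(z)` is an algebraic number. -/
theorem jinv_isAlgebraic_of_CM (z : ℂ) (hz : 0 < z.im)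
    (A B C : ℤ) (hA : A ≠ 0)
    (hquad : (A : ℂ) * z ^ 2 + (B : ℂ) * z + (C : ℂ) = 0) :
    IsAlgebraic ℚ (jinv z) := by
  have h := jinv_eq ⟨z, hz⟩
  change jinv z = _ at h
  rw [h, show (1728 : ℂ) = algebraMap ℚ ℂ 1728 by simp]
  exact (isAlgebraic_algebraMap (A := ℂ) (1728 : ℚ)).mul (Jf_CM ⟨z, hz⟩ A B C hA hquad)
end
end
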